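/- arXiv:2507.18152 — 4 statements merged into one kernel-verified Lean document; each statement's English description precedes it below -/
import Mathlib

section
/- For α, v, w > 0, the residue of the Barnes double zeta-function ζ₂(s, α; v, w) at s = 1 equals (v + w − 2α)/(2vw). -/
open Filter Topology

noncomputable def bF (α v w : ℝ) (t : ℝ) : ℝ :=
  Real.exp (-α * t) * (1 - Real.exp (-v * t))⁻¹ * (1 - Real.exp (-w * t))⁻¹

lemma b_summable (α v w : ℝ) (hα : 0 < α) (hv : 0 < v) (hw : 0 < w) (σ : ℝ) (hσ : 2 < σ) :
    Summable fun p : ℕ × ℕ => ‖(1:ℂ)‖ / (α + (p.1 : ℝ) * v + (p.2 : ℝ) * w) ^ σ := by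
  have key : ∀ u : ℝ, 0 < u → Summable fun n : ℕ => 1 / (α / 2 + n * u) ^ (σ / 2) := by
    intro u hu
    have h := (Real.summable_one_div_nat_add_rpow (α / 2 / u) (σ / 2)).2 (by linarith)
    refine (h.mul_left (1 / u ^ (σ / 2))).congr fun n => ?_
    have h1 : (0:ℝ) < n + α / 2 / u := by positivity
    rw [abs_of_pos h1, one_div_mul_one_div_rev, ← Real.mul_rpow h1.le hu.le]
    congr 2
    field_simp
    ring
  refine Summable.of_nonneg_of_le (fun p => by positivity) (fun p => ?_)
    ((key v hv).mul_of_nonneg (key w hw) (fun n => by positivity) (fun n => by positivity))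
  have hA : 0 < α / 2 + p.1 * v := by positivity
  have hB : 0 < α / 2 + p.2 * w := by positivity
  rw [norm_one, one_div_mul_one_div_rev, ← Real.mul_rpow hB.le hA.le]
  apply one_div_le_one_div_of_le (by positivity)
  have : ((α / 2 + p.2 * w) * (α / 2 + p.1 * v)) ≤ (α + (p.1 : ℝ) * v + (p.2 : ℝ) * w) ^ 2 := by
    nlinarith
  refine (Real.rpow_le_rpow (by positivity) this (by linarith)).trans_eq ?_
  rw [← Real.rpow_natCast, ← Real.rpow_mul (by positivity)]
  congr 1
  push_cast
  ring

lemma b_hasSum (α v w : ℝ) (hv : 0 < v) (hw : 0 < w) (t : ℝ) (ht : 0 < t) :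
    HasSum (fun p : ℕ × ℕ => (1:ℂ) * (Real.exp (-(α + (p.1 : ℝ) * v + (p.2 : ℝ) * w) * t) : ℂ))
      (bF α v w t : ℂ) := by
  have g : ∀ u : ℝ, 0 < u → HasSum (fun n : ℕ => Real.exp (-u * t) ^ n) (1 - Real.exp (-u * t))⁻¹ := by
    intro u hu
    apply hasSum_geometric_of_lt_one (Real.exp_pos _).le
    rw [Real.exp_lt_one_iff]
    nlinarith [mul_pos hu ht]
  have h := ((g v hv).mul (g w hw) ((g v hv).summable.mul_of_nonneg (g w hw).summable
    (fun n => by positivity) (fun n => by positivity))).mul_left (Real.exp (-α * t))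
  simp only [one_mul]
  rw [Complex.hasSum_ofReal]
  have hb : bF α v w t = Real.exp (-α * t) * ((1 - Real.exp (-v * t))⁻¹ *
      (1 - Real.exp (-w * t))⁻¹) := by simp only [bF]; ring
  rw [hb]
  have hf : (fun p : ℕ × ℕ => Real.exp (-(α + (p.1 : ℝ) * v + (p.2 : ℝ) * w) * t)) =
      fun i => Real.exp (-α * t) * (Real.exp (-v * t) ^ i.1 * Real.exp (-w * t) ^ i.2) := by
    funext p
    rw [← Real.exp_nat_mul, ← Real.exp_nat_mul, ← Real.exp_add, ← Real.exp_add]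
    congr 1
    ring
  rw [hf]
  exact h

lemma b_mellin (α v w : ℝ) (hα : 0 < α) (hv : 0 < v) (hw : 0 < w) (s : ℂ) (hs : 2 < s.re) :
    ∑' p : ℕ × ℕ, ((α + (p.1 : ℝ) * v + (p.2 : ℝ) * w : ℝ) : ℂ) ^ (-s)
      = (Complex.Gamma s)⁻¹ * mellin (fun t => (bF α v w t : ℂ)) s := by
  have h := hasSum_mellin (a := fun _ : ℕ × ℕ => (1:ℂ))
    (p := fun p => α + (p.1 : ℝ) * v + (p.2 : ℝ) * w) (s := s)
    (fun i => Or.inr (by positivity)) (by linarith)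
    (fun t ht => b_hasSum α v w hv hw t ht) (b_summable α v w hα hv hw s.re hs)
  have h2 := h.mul_left (Complex.Gamma s)⁻¹
  rw [← h2.tsum_eq]
  congr 1
  ext p
  have : Complex.Gamma s ≠ 0 := Complex.Gamma_ne_zero_of_re_pos (by linarith)
  rw [Complex.cpow_neg]
  field_simp

open Asymptotics in
lemma b_taylor (u : ℝ) (n : ℕ) :
    (fun t : ℝ => (Real.exp (-u * t) - ∑ i ∈ Finset.range n, (-u * t) ^ i / i.factorial) / t ^ n)
      =O[𝓝[>] 0] (fun _ => (1:ℝ)) := by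
  have h := Real.exp_sub_sum_range_isBigO_pow n
  have ht : Tendsto (fun t : ℝ => -u * t) (𝓝[>] 0) (𝓝 0) := by
    have : Continuous (fun t : ℝ => -u * t) := by fun_prop
    simpa using (this.tendsto 0).mono_left nhdsWithin_le_nhds
  have h1 := h.comp_tendsto ht
  have h2 : ((fun x : ℝ => x ^ n) ∘ fun t : ℝ => -u * t) =O[𝓝[>] 0] (fun t : ℝ => t ^ n) := by
    simp only [Function.comp_def, mul_pow]
    exact isBigO_const_mul_self _ _ _
  have h3 := (h1.trans h2).mul (isBigO_refl (fun t : ℝ => (t ^ n)⁻¹) (𝓝[>] 0))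
  refine (h3.congr' ?_ ?_)
  · exact Eventually.of_forall fun t => by simp [div_eq_mul_inv]
  · filter_upwards [self_mem_nhdsWithin] with t ht
    have : t ≠ 0 := ne_of_gt ht
    field_simp

open Asymptotics in
lemma b_zero (α v w : ℝ) (hv : 0 < v) (hw : 0 < w) :
    (fun t : ℝ => bF α v w t - 1 / (v * w) * t⁻¹ ^ 2 - (v + w - 2 * α) / (2 * v * w) * t⁻¹)
      =O[𝓝[>] 0] (fun _ => (1:ℝ)) := by
  set A : ℝ → ℝ := fun t => (Real.exp (-α * t) - ∑ i ∈ Finset.range 2, (-α * t) ^ i / i.factorial) / t ^ 2 with hA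
  set B : ℝ → ℝ → ℝ := fun u t => (Real.exp (-u * t) - ∑ i ∈ Finset.range 3, (-u * t) ^ i / i.factorial) / t ^ 3 with hB
  have oA : A =O[𝓝[>] 0] (fun _ => (1:ℝ)) := b_taylor α 2
  have oB : ∀ u, B u =O[𝓝[>] 0] (fun _ => (1:ℝ)) := fun u => b_taylor u 3
  have oc : ∀ f : ℝ → ℝ, Continuous f → f =O[𝓝[>] 0] (fun _ => (1:ℝ)) := fun f hf =>
    ((hf.tendsto 0).mono_left nhdsWithin_le_nhds).isBigO_one ℝ
  have om : ∀ {f g : ℝ → ℝ}, f =O[𝓝[>] 0] (fun _ => (1:ℝ)) → g =O[𝓝[>] 0] (fun _ => (1:ℝ)) →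
      (fun t => f t * g t) =O[𝓝[>] 0] (fun _ => (1:ℝ)) := fun hf hg => by
    simpa using hf.mul hg
  have oI : ∀ u : ℝ, 0 < u → (fun t => t * (1 - Real.exp (-u * t))⁻¹) =O[𝓝[>] 0] (fun _ => (1:ℝ)) := by
    intro u hu
    have hd : HasDerivAt (fun t : ℝ => 1 - Real.exp (-u * t)) u 0 := by
      have := (((hasDerivAt_id (0:ℝ)).const_mul (-u)).exp).const_sub 1
      simpa using this
    have := (hd.tendsto_slope.mono_left (nhdsWithin_mono 0 (fun x hx => ne_of_gt hx : Set.Ioi (0:ℝ) ⊆ {0}ᶜ))).inv₀ hu.ne'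
    refine (this.isBigO_one ℝ).congr_left fun t => ?_
    simp [slope_def_field, div_eq_mul_inv]
  set k := (v + w) / 2 - α with hk
  set S : ℝ → ℝ := fun t => v * w / 4 - (B v t / v) * (1 - w * t / 2 - t ^ 2 * (B w t / w))
    - (B w t / w) * (1 - v * t / 2) with hS
  have oBd : ∀ u c, (fun t => B u t / c) =O[𝓝[>] 0] (fun _ => (1:ℝ)) := fun u c => by
    simpa [div_eq_mul_inv] using om (oB u) (oc (fun _ => c⁻¹) (by fun_prop))
  have oS : S =O[𝓝[>] 0] (fun _ => (1:ℝ)) :=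
    ((oc (fun _ => v * w / 4) (by fun_prop)).sub (om (oBd v v)
      ((oc (fun t => 1 - w * t / 2) (by fun_prop)).sub
        (om (oc (fun t => t ^ 2) (by fun_prop)) (oBd w w))))).sub
      (om (oBd w w) (oc (fun t => 1 - v * t / 2) (by fun_prop)))
  have oQ : (fun t => A t + k * (k + α) - (1 + k * t) * S t) =O[𝓝[>] 0] (fun _ => (1:ℝ)) :=
    (oA.add (oc (fun _ => k * (k + α)) (by fun_prop))).sub
      (om (oc (fun t => 1 + k * t) (by fun_prop)) oS)
  refine (om (om oQ (oI v hv)) (oI w hw)).congr' ?_ EventuallyEq.rfl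
  filter_upwards [self_mem_nhdsWithin] with t (ht : 0 < t)
  have e1 : Real.exp (-α * t) = 1 - α * t + t ^ 2 * A t := by
    simp only [hA, Finset.sum_range_succ]
    simp
    field_simp
    ring
  have e2 : ∀ u, Real.exp (-u * t) = 1 - u * t + u ^ 2 * t ^ 2 / 2 + t ^ 3 * B u t := by
    intro u
    simp only [hB, Finset.sum_range_succ]
    simp [Nat.factorial]
    field_simp
    ring
  have ne : ∀ u : ℝ, 0 < u → 1 - Real.exp (-u * t) ≠ 0 := by
    intro u hu
    have : Real.exp (-u * t) < 1 := by
      rw [Real.exp_lt_one_iff]; nlinarith [mul_pos hu ht]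
    linarith
  have nv := ne v hv
  have nw := ne w hw
  have main : (A t + k * (k + α) - (1 + k * t) * S t) * t ^ 4 = t ^ 2 * Real.exp (-α * t)
      - (1 + k * t) / (v * w) * ((1 - Real.exp (-v * t)) * (1 - Real.exp (-w * t))) := by
    rw [e1, e2 v, e2 w]
    simp only [hS, hk]
    generalize A t = a
    generalize B v t = b
    generalize B w t = b'
    field_simp
    ring
  have e3 : 1 / (v * w) * t⁻¹ ^ 2 + (v + w - 2 * α) / (2 * v * w) * t⁻¹ = (1 + k * t) / (v * w) / t ^ 2 := by
    simp only [hk]; field_simp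
  rw [sub_sub, e3, bF]
  generalize Real.exp (-α * t) = x at *
  generalize 1 - Real.exp (-v * t) = y at *
  generalize 1 - Real.exp (-w * t) = z at *
  generalize A t + k * (k + α) - (1 + k * t) * S t = q at *
  have hq : q = (t ^ 2 * x - (1 + k * t) / (v * w) * (y * z)) / t ^ 4 := by
    rw [← main]; field_simp
  rw [hq]
  field_simp


/-- The polar part cut off at `1`. -/
noncomputable def bI (k : ℂ) : ℝ → ℂ :=
  Set.indicator (Set.Ioc 0 1) (fun t : ℝ => (t : ℂ) ^ k)

noncomputable def bG (α v w : ℝ) (t : ℝ) : ℂ :=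
  (bF α v w t : ℂ) - (((1 / (v * w) : ℝ) : ℂ) • bI (-2) t
    + (((v + w - 2 * α) / (2 * v * w) : ℝ) : ℂ) • bI (-1) t)

lemma bI_locInt (k : ℂ) : MeasureTheory.LocallyIntegrableOn (bI k) (Set.Ioi 0) := by
  have hc : ContinuousOn (fun t : ℝ => (t : ℂ) ^ k) (Set.Ioi 0) := by
    intro t ht
    exact (Complex.continuousAt_ofReal_cpow_const t k (Or.inr (ne_of_gt ht))).continuousWithinAt
  intro x hx
  obtain ⟨U, hU, hU'⟩ := hc.locallyIntegrableOn (μ := MeasureTheory.volume) measurableSet_Ioi x hx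
  exact ⟨U, hU, hU'.indicator measurableSet_Ioc⟩

lemma one_sub_exp_pos' (u t : ℝ) (hu : 0 < u) (ht : 0 < t) : 0 < 1 - Real.exp (-u * t) := by
  have : Real.exp (-u * t) < 1 := by
    rw [Real.exp_lt_one_iff]; nlinarith [mul_pos hu ht]
  linarith

lemma bG_locInt (α v w : ℝ) (hv : 0 < v) (hw : 0 < w) :
    MeasureTheory.LocallyIntegrableOn (bG α v w) (Set.Ioi 0) := by
  have hc : ContinuousOn (fun t : ℝ => (bF α v w t : ℂ)) (Set.Ioi 0) := by
    apply Complex.continuous_ofReal.comp_continuousOn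
    unfold bF
    refine ContinuousOn.mul (ContinuousOn.mul (by fun_prop) ?_) ?_
    · exact ContinuousOn.inv₀ (by fun_prop) fun t ht => (one_sub_exp_pos' v t hv ht).ne'
    · exact ContinuousOn.inv₀ (by fun_prop) fun t ht => (one_sub_exp_pos' w t hw ht).ne'
  have h1 := hc.locallyIntegrableOn (μ := MeasureTheory.volume) measurableSet_Ioi
  have h2 := (bI_locInt (-2)).smul ((1 / (v * w) : ℝ) : ℂ)
  have h3 := (bI_locInt (-1)).smul (((v + w - 2 * α) / (2 * v * w) : ℝ) : ℂ)
  have h4 := h1.sub (h2.add h3)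
  have e : bG α v w = (fun t : ℝ => (bF α v w t : ℂ)) - (((1 / (v * w) : ℝ) : ℂ) • bI (-2)
      + (((v + w - 2 * α) / (2 * v * w) : ℝ) : ℂ) • bI (-1)) := by
    funext t
    rfl
  rw [e]
  exact h4

open Asymptotics in
lemma bG_top (α v w : ℝ) (hv : 0 < v) (hw : 0 < w) :
    bG α v w =O[atTop] fun t => Real.exp (-α * t) := by
  have hlim : ∀ u : ℝ, 0 < u →
      (fun t : ℝ => (1 - Real.exp (-u * t))⁻¹) =O[atTop] (fun _ => (1:ℝ)) := by
    intro u hu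
    have h1 : Tendsto (fun t : ℝ => Real.exp (-u * t)) atTop (𝓝 0) := by
      apply Real.tendsto_exp_atBot.comp
      exact tendsto_id.const_mul_atTop_of_neg (by linarith)
    have h2 := (h1.const_sub 1).inv₀ (by norm_num)
    exact h2.isBigO_one ℝ
  have h := ((isBigO_refl (fun t : ℝ => Real.exp (-α * t)) atTop).mul (hlim v hv)).mul (hlim w hw)
  simp only [mul_one] at h
  have h' : (fun t => (bF α v w t : ℂ)) =O[atTop] fun t => Real.exp (-α * t) := by
    refine IsBigO.trans (IsBigO.of_bound 1 (Eventually.of_forall fun t => ?_))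
      (h : (bF α v w) =O[atTop] fun t => Real.exp (-α * t))
    rw [Complex.norm_real, one_mul]
    exact le_rfl
  refine h'.congr' ?_ EventuallyEq.rfl
  filter_upwards [eventually_gt_atTop 1] with t ht
  simp [bG, bI, ht]

open Asymptotics in
lemma bG_bot (α v w : ℝ) (hv : 0 < v) (hw : 0 < w) :
    bG α v w =O[𝓝[>] 0] fun t : ℝ => t ^ (-0 : ℝ) := by
  have h := b_zero α v w hv hw
  simp only [neg_zero, Real.rpow_zero]
  refine IsBigO.trans (IsBigO.of_bound 1 ?_) h
  filter_upwards [Ioc_mem_nhdsGT (zero_lt_one (α := ℝ))] with t ht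
  have h0 : (t : ℂ) ≠ 0 := by exact_mod_cast ht.1.ne'
  have : bG α v w t = ((bF α v w t - 1 / (v * w) * t⁻¹ ^ 2 -
      (v + w - 2 * α) / (2 * v * w) * t⁻¹ : ℝ) : ℂ) := by
    have e2 : (t : ℂ) ^ (-2 : ℂ) = (t : ℂ)⁻¹ ^ 2 := by
      rw [Complex.cpow_neg]
      norm_num
    simp only [bG, bI, Set.indicator_of_mem ht, e2, Complex.cpow_neg_one, smul_eq_mul]
    push_cast
    ring
  rw [this, Complex.norm_real, one_mul]

lemma b_mellin_F (α v w : ℝ) (hα : 0 < α) (hv : 0 < v) (hw : 0 < w) (s : ℂ) (hs : 2 < s.re) :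
    mellin (fun t => (bF α v w t : ℂ)) s = mellin (bG α v w) s +
      (((1 / (v * w) : ℝ) : ℂ) * (1 / (s - 2)) +
        (((v + w - 2 * α) / (2 * v * w) : ℝ) : ℂ) * (1 / (s - 1))) := by
  have hG : MellinConvergent (bG α v w) s :=
    mellinConvergent_of_isBigO_rpow_exp hα (bG_locInt α v w hv hw) (bG_top α v w hv hw)
      (bG_bot α v w hv hw) (by linarith)
  have h2 : HasMellin (bI (-2)) s (1 / (s + -2)) := hasMellin_cpow_Ioc (-2) (by simp; linarith)
  have h1 : HasMellin (bI (-1)) s (1 / (s + -1)) := hasMellin_cpow_Ioc (-1) (by simp; linarith)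
  have k2 := hasMellin_const_smul h2.1 ((1 / (v * w) : ℝ) : ℂ)
  have k1 := hasMellin_const_smul h1.1 (((v + w - 2 * α) / (2 * v * w) : ℝ) : ℂ)
  have k := hasMellin_add k2.1 k1.1
  have K := (hasMellin_add hG k.1).2
  rw [k.2, k2.2, k1.2, h2.2, h1.2] at K
  rw [sub_eq_add_neg s 2, sub_eq_add_neg s 1]
  simp only [smul_eq_mul] at K
  rw [← K]
  congr 1
  funext t
  simp [bG]

noncomputable def bZ (α v w : ℝ) (s : ℂ) : ℂ :=
  (Complex.Gamma s)⁻¹ * (mellin (bG α v w) s +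
      (((1 / (v * w) : ℝ) : ℂ) * (1 / (s - 2)) +
        (((v + w - 2 * α) / (2 * v * w) : ℝ) : ℂ) * (1 / (s - 1))))

lemma b_diff (α v w : ℝ) (hα : 0 < α) (hv : 0 < v) (hw : 0 < w) (s : ℂ) (hs : 0 < s.re) :
    DifferentiableAt ℂ (mellin (bG α v w)) s :=
  mellin_differentiableAt_of_isBigO_rpow_exp hα (bG_locInt α v w hv hw) (bG_top α v w hv hw)
      (bG_bot α v w hv hw) hs

lemma bZ_mero (α v w : ℝ) (hα : 0 < α) (hv : 0 < v) (hw : 0 < w) :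
    MeromorphicOn (bZ α v w) {s : ℂ | 0 < s.re} := by
  intro s hs
  have ho : IsOpen {s : ℂ | 0 < s.re} := isOpen_lt continuous_const Complex.continuous_re
  have h1 : AnalyticAt ℂ (mellin (bG α v w)) s :=
    (DifferentiableOn.analyticAt (s := {s : ℂ | 0 < s.re})
      (fun z hz => (b_diff α v w hα hv hw z hz).differentiableWithinAt) (ho.mem_nhds hs))
  have h2 : AnalyticAt ℂ (fun s : ℂ => (Complex.Gamma s)⁻¹) s :=
    Complex.differentiable_one_div_Gamma.analyticAt s
  have h1' := h1.meromorphicAt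
  have h2' := h2.meromorphicAt
  have h3 : ∀ c : ℂ, MeromorphicAt (fun s : ℂ => 1 / (s - c)) s := fun c =>
    (MeromorphicAt.const 1 s).div ((MeromorphicAt.id s).sub (MeromorphicAt.const c s))
  exact h2'.mul (h1'.add (((MeromorphicAt.const _ s).mul (h3 2)).add
    ((MeromorphicAt.const _ s).mul (h3 1))))

lemma bZ_res (α v w : ℝ) (hα : 0 < α) (hv : 0 < v) (hw : 0 < w) :
    Tendsto (fun s : ℂ => (s - 1) * bZ α v w s) (𝓝[≠] (1 : ℂ))
      (𝓝 (((v + w - 2 * α) / (2 * v * w) : ℝ) : ℂ)) := by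
  set c : ℂ := (((v + w - 2 * α) / (2 * v * w) : ℝ) : ℂ) with hc
  have hG : ContinuousAt (fun s : ℂ => (Complex.Gamma s)⁻¹) 1 :=
    Complex.differentiable_one_div_Gamma.continuous.continuousAt
  have hM : ContinuousAt (mellin (bG α v w)) 1 :=
    (b_diff α v w hα hv hw 1 (by simp)).continuousAt
  have hI : ContinuousAt (fun s : ℂ => 1 / (s - 2)) 1 :=
    ContinuousAt.div (by fun_prop) (by fun_prop) (by norm_num)
  have hcont : ContinuousAt (fun s : ℂ => (Complex.Gamma s)⁻¹ *
      ((s - 1) * (mellin (bG α v w) s + ((1 / (v * w) : ℝ) : ℂ) * (1 / (s - 2))) + c)) 1 := by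
    refine hG.mul (ContinuousAt.add (ContinuousAt.mul (by fun_prop) (hM.add ?_)) (by fun_prop))
    exact ContinuousAt.mul (by fun_prop) hI
  have ht := hcont.tendsto.mono_left (nhdsWithin_le_nhds (s := {1}ᶜ))
  simp only [sub_self, zero_mul, zero_add, Complex.Gamma_one, inv_one, one_mul] at ht
  refine ht.congr' ?_
  filter_upwards [self_mem_nhdsWithin] with s hs
  have : s - 1 ≠ 0 := sub_ne_zero.2 hs
  simp only [bZ, ← hc]
  generalize 1 / (s - 2) = x
  field_simp
  ring

/-- The meromorphic continuation `Z` of the Barnes double zeta-function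
`ζ₂(s, α; v, w)` has residue `(v + w − 2α)/(2vw)` at `s = 1`. -/
theorem barnes_double_zeta_residue_at_one
    (α v w : ℝ) (hα : 0 < α) (hv : 0 < v) (hw : 0 < w)
    (Z : ℂ → ℂ)
    (hmero : MeromorphicOn Z Set.univ)
    (hZ : ∀ s : ℂ, 2 < s.re →
      Z s = ∑' p : ℕ × ℕ, ((α + (p.1 : ℝ) * v + (p.2 : ℝ) * w : ℝ) : ℂ) ^ (-s)) :
    Tendsto (fun s : ℂ => (s - 1) * Z s) (𝓝[≠] (1 : ℂ))
      (𝓝 (((v + w - 2 * α) / (2 * v * w) : ℝ) : ℂ)) := by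
  have hD : MeromorphicOn (Z - bZ α v w) {s : ℂ | 0 < s.re} := fun s hs =>
    (hmero s (Set.mem_univ s)).sub (bZ_mero α v w hα hv hw s hs)
  have hU : IsPreconnected {s : ℂ | 0 < s.re} := (convex_halfSpace_re_gt 0).isPreconnected
  have h3 : meromorphicOrderAt (Z - bZ α v w) 3 = ⊤ := by
    rw [meromorphicOrderAt_eq_top_iff]
    have ho : IsOpen {s : ℂ | 2 < s.re} := isOpen_lt continuous_const Complex.continuous_re
    filter_upwards [nhdsWithin_le_nhds (ho.mem_nhds (by norm_num : (3 : ℂ) ∈ {s : ℂ | 2 < s.re}))]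
      with s hs
    have hs' : 2 < s.re := hs
    rw [Pi.sub_apply, hZ s hs', b_mellin α v w hα hv hw s hs', b_mellin_F α v w hα hv hw s hs']
    simp [bZ]
  have h1 : meromorphicOrderAt (Z - bZ α v w) 1 = ⊤ := by
    by_contra h
    exact hD.meromorphicOrderAt_ne_top_of_isPreconnected hU (x := 1) (y := 3) (by simp) (by simp)
      h h3
  rw [meromorphicOrderAt_eq_top_iff] at h1
  refine (bZ_res α v w hα hv hw).congr' ?_
  filter_upwards [h1] with s hs
  rw [sub_eq_zero.1 hs]
end

section
/- For 0 < a ≤ 1 and every natural number k ≥ 1, the generalized Stieltjes constant γ_k(a) = ((−1)^k/k!)·lim_{M→∞}( ∑_{m=0}^{M} log^k(m+a)/(m+a) − log^{k+1}(M+a)/(k+1) ) satisfies |γ_k(a) − (−1)^k log^k(a)/(a·k!)| ≤ (3 + (−1)^k)/(k·π^k). -/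
open Filter Topology

open Polynomial in
noncomputable def bbQ (k : ℕ) : ℕ → Polynomial ℝ
  | 0 => X ^ k
  | n + 1 => derivative (bbQ k n) - C ((n : ℝ) + 1) * bbQ k n

noncomputable def bbG (k n : ℕ) (x : ℝ) : ℝ := (bbQ k n).eval (Real.log x) * (x ^ (n + 1))⁻¹

noncomputable def bbB (n : ℕ) (x : ℝ) : ℝ := bernoulliFun n x / (n.factorial : ℝ)

lemma bbQ_coeff_succ (k n j : ℕ) : (bbQ k (n + 1)).coeff j =
    (bbQ k n).coeff (j + 1) * ((j : ℝ) + 1) - ((n : ℝ) + 1) * (bbQ k n).coeff j := by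
  simp [bbQ, Polynomial.coeff_derivative, -map_add, -map_natCast, Polynomial.coeff_C_mul]

lemma bbQ_coeff_low (k n : ℕ) : ∀ j, j + n < k → (bbQ k n).coeff j = 0 := by
  induction n with
  | zero => intro j hj; simp [bbQ, Polynomial.coeff_X_pow]; omega
  | succ n ih =>
    intro j hj
    rw [bbQ_coeff_succ, ih _ (by omega), ih _ (by omega)]; simp

lemma bbQ_coeff_high (k n : ℕ) : ∀ j, k < j → (bbQ k n).coeff j = 0 := by
  induction n with
  | zero => intro j hj; simp [bbQ, Polynomial.coeff_X_pow]; omega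
  | succ n ih =>
    intro j hj
    rw [bbQ_coeff_succ, ih _ (by omega), ih _ (by omega)]; simp

lemma bbQ_eval (k n : ℕ) (x : ℝ) : (bbQ k n).eval x =
    ∑ j ∈ Finset.range (k + 1), (bbQ k n).coeff j * x ^ j := by
  apply Polynomial.eval_eq_sum_range'
  rw [Nat.lt_succ_iff, Polynomial.natDegree_le_iff_coeff_eq_zero]
  exact bbQ_coeff_high k n

lemma bbG_one (k n : ℕ) (h : n < k) : bbG k n 1 = 0 := by
  simp [bbG, ← Polynomial.coeff_zero_eq_eval_zero, bbQ_coeff_low k n 0 (by omega)]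

lemma bbG_deriv (k n : ℕ) (x : ℝ) (hx : 0 < x) : HasDerivAt (bbG k n) (bbG k (n + 1) x) x := by
  have h1 := ((bbQ k n).hasDerivAt (Real.log x)).comp x (Real.hasDerivAt_log hx.ne')
  have h2 := (hasDerivAt_pow (n + 1) x).inv (pow_pos hx _).ne'
  have h3 := h1.mul h2
  refine h3.congr_deriv ?_
  simp only [bbG, bbQ, Function.comp, Pi.inv_apply, Polynomial.eval_sub, Polynomial.eval_mul, Polynomial.eval_C]
  simp only [Nat.add_sub_cancel]
  field_simp
  push_cast
  ring

lemma bbG_tendsto (k n : ℕ) (a : ℝ) :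
    Tendsto (fun M : ℕ => bbG k n ((M : ℝ) + 1 + a)) atTop (𝓝 0) := by
  have hx : Tendsto (fun M : ℕ => (M : ℝ) + 1 + a) atTop atTop :=
    tendsto_atTop_add_const_right _ _ (tendsto_atTop_add_const_right _ _ tendsto_natCast_atTop_atTop)
  have key : Tendsto (bbG k n) atTop (𝓝 0) := by
    have h1 : ∀ j : ℕ, Tendsto (fun x : ℝ => Real.log x ^ j / x) atTop (𝓝 0) := fun j =>
      (Real.isLittleO_pow_log_id_atTop (n := j)).tendsto_div_nhds_zero
    have h2 : Tendsto (fun x : ℝ => ∑ j ∈ Finset.range (k + 1),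
        (bbQ k n).coeff j * (Real.log x ^ j / x)) atTop (𝓝 0) := by
      have := tendsto_finsetSum (Finset.range (k + 1))
        (fun j _ => (h1 j).const_mul ((bbQ k n).coeff j))
      simpa using this
    have h3 : Tendsto (fun x : ℝ => |∑ j ∈ Finset.range (k + 1),
        (bbQ k n).coeff j * (Real.log x ^ j / x)|) atTop (𝓝 0) := by
      simpa using h2.abs
    refine squeeze_zero_norm' ?_ h3
    filter_upwards [eventually_ge_atTop (1 : ℝ)] with x hx
    have e : ∑ j ∈ Finset.range (k + 1), (bbQ k n).coeff j * (Real.log x ^ j / x)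
        = (bbQ k n).eval (Real.log x) * x⁻¹ := by
      rw [bbQ_eval, Finset.sum_mul]
      refine Finset.sum_congr rfl fun j _ => ?_
      ring
    rw [e, bbG, Real.norm_eq_abs, abs_mul, abs_mul]
    refine mul_le_mul_of_nonneg_left ?_ (abs_nonneg _)
    have hx0 : 0 < x := by linarith
    rw [abs_of_pos (by positivity), abs_of_pos (by positivity)]
    apply inv_anti₀ hx0
    exact le_self_pow₀ hx (by omega)
  exact key.comp hx

lemma bbG_contOn (k n : ℕ) (c d : ℝ) (hc : 0 < c) (hd : 0 < d) :
    ContinuousOn (bbG k n) (Set.uIcc c d) := by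
  intro x hx
  have : 0 < x := lt_of_lt_of_le (lt_min hc hd) hx.1
  exact (bbG_deriv k n x this).continuousAt.continuousWithinAt

lemma bbB_deriv (n : ℕ) (x : ℝ) : HasDerivAt (bbB (n + 1)) (bbB n x) x := by
  have := (hasDerivAt_bernoulliFun (n + 1) x).div_const ((n + 1).factorial : ℝ)
  refine this.congr_deriv ?_
  simp only [bbB, Nat.add_sub_cancel, Nat.factorial_succ]
  push_cast
  field_simp

lemma bbB_cont (n : ℕ) : Continuous (bbB n) := (continuous_bernoulliFun n).div_const _

lemma bb_piece (k n : ℕ) (e c d : ℝ) (hc : 0 < c) (hd : 0 < d) :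
    ∫ x in c..d, bbB n (x - e) * bbG k n x =
      bbB (n + 1) (d - e) * bbG k n d - bbB (n + 1) (c - e) * bbG k n c
        - ∫ x in c..d, bbB (n + 1) (x - e) * bbG k (n + 1) x := by
  have h := intervalIntegral.integral_mul_deriv_eq_deriv_mul (a := c) (b := d)
    (u := fun x => bbB (n + 1) (x - e)) (u' := fun x => bbB n (x - e))
    (v := bbG k n) (v' := bbG k (n + 1))
    (fun x _ => by simpa using (bbB_deriv n (x - e)).comp_sub_const x e)
    (fun x hx => bbG_deriv k n x (lt_of_lt_of_le (lt_min hc hd) hx.1))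
    (((bbB_cont n).comp (continuous_id.sub continuous_const)).intervalIntegrable _ _)
    ((bbG_contOn k (n + 1) c d hc hd).intervalIntegrable)
  linarith

noncomputable def bbR (a : ℝ) (k n M : ℕ) : ℝ :=
  (∫ x in (1 : ℝ)..(1 + a), bbB n (x - a) * bbG k n x) +
    ∑ m ∈ Finset.range M, ∫ x in ((m : ℝ) + 1 + a)..((m : ℝ) + 1 + a + 1),
      bbB n (x - ((m : ℝ) + 1 + a)) * bbG k n x

lemma bbB_one (n : ℕ) (hn : 2 ≤ n) : bbB n 1 = bbB n 0 := by
  simp [bbB, bernoulliFun_endpoints_eq_of_ne_one (show n ≠ 1 by omega)]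

lemma bbR_step (a : ℝ) (ha : 0 < a) (k n M : ℕ) (hn : 1 ≤ n) (hnk : n < k) :
    bbR a k n M = bbB (n + 1) 0 * bbG k n ((M : ℝ) + 1 + a) - bbR a k (n + 1) M := by
  induction M with
  | zero =>
    simp only [bbR, Finset.range_zero, Finset.sum_empty, add_zero]
    rw [bb_piece k n a 1 (1 + a) one_pos (by positivity), bbG_one k n hnk]
    rw [show 1 + a - a = 1 by ring, bbB_one (n + 1) (by omega)]
    simp
  | succ M ih =>
    have e : ∀ n, bbR a k n (M + 1) = bbR a k n M +
      ∫ x in ((M : ℝ) + 1 + a)..((M : ℝ) + 1 + a + 1),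
      bbB n (x - ((M : ℝ) + 1 + a)) * bbG k n x := by
      intro n; simp only [bbR, Finset.sum_range_succ]; ring
    rw [e, e, ih, bb_piece k n _ _ _ (by positivity) (by positivity)]
    rw [add_sub_cancel_left, sub_self, bbB_one (n + 1) (by omega)]
    push_cast
    rw [show (M : ℝ) + 1 + a + 1 = (M : ℝ) + 1 + 1 + a by ring]
    ring

lemma bbR_zero (a : ℝ) (ha : 0 < a) (k M : ℕ) (hk : 1 ≤ k) :
    bbR a k 0 M = (∑ m ∈ Finset.range (M + 1), bbG k 0 ((m : ℝ) + 1 + a))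
      - bbG k 0 ((M : ℝ) + 1 + a) / 2 - bbR a k 1 M := by
  induction M with
  | zero =>
    simp only [bbR, Finset.range_zero, Finset.sum_empty, add_zero, zero_add, Finset.range_one,
      Finset.sum_singleton, Nat.cast_zero]
    rw [bb_piece k 0 a 1 (1 + a) one_pos (by positivity), bbG_one k 0 hk]
    rw [show 1 + a - a = 1 by ring]
    simp [bbB]
    ring
  | succ M ih =>
    have e : ∀ n, bbR a k n (M + 1) = bbR a k n M +
      ∫ x in ((M : ℝ) + 1 + a)..((M : ℝ) + 1 + a + 1),
      bbB n (x - ((M : ℝ) + 1 + a)) * bbG k n x := by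
      intro n; simp only [bbR, Finset.sum_range_succ]; ring
    rw [e, e, ih, bb_piece k 0 _ _ _ (by positivity) (by positivity),
      Finset.sum_range_succ _ (M + 1)]
    rw [add_sub_cancel_left, sub_self]
    push_cast
    rw [show (M : ℝ) + 1 + a + 1 = (M : ℝ) + 1 + 1 + a by ring]
    simp [bbB]
    ring

lemma bbR_zero_eq (a : ℝ) (ha : 0 < a) (k M : ℕ) :
    bbR a k 0 M = Real.log ((M : ℝ) + 1 + a) ^ (k + 1) / (k + 1) := by
  have key : ∀ c d : ℝ, 0 < c → 0 < d → ∀ e : ℝ, ∫ x in c..d, bbB 0 (x - e) * bbG k 0 x =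
      Real.log d ^ (k + 1) / (k + 1) - Real.log c ^ (k + 1) / (k + 1) := by
    intro c d hc hd e
    have : (fun x => bbB 0 (x - e) * bbG k 0 x) = bbG k 0 := by
      funext x; simp [bbB]
    rw [this]
    refine intervalIntegral.integral_eq_sub_of_hasDerivAt
      (f := fun x => Real.log x ^ (k + 1) / (k + 1)) ?_
      ((bbG_contOn k 0 c d hc hd).intervalIntegrable)
    intro x hx
    have hx0 : 0 < x := lt_of_lt_of_le (lt_min hc hd) hx.1
    have := ((Real.hasDerivAt_log hx0.ne').pow (k + 1)).div_const ((k : ℝ) + 1)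
    refine this.congr_deriv ?_
    simp [bbG, bbQ]
    field_simp
  induction M with
  | zero => simp [bbR, key 1 (1 + a) one_pos (by positivity)]
  | succ M ih =>
    have e : bbR a k 0 (M + 1) = bbR a k 0 M +
      ∫ x in ((M : ℝ) + 1 + a)..((M : ℝ) + 1 + a + 1),
      bbB 0 (x - ((M : ℝ) + 1 + a)) * bbG k 0 x := by
      simp only [bbR, Finset.sum_range_succ]; ring
    rw [e, ih, key _ _ (by positivity) (by positivity)]
    push_cast
    rw [show (M : ℝ) + 1 + a + 1 = (M : ℝ) + 1 + 1 + a by ring]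
    ring

lemma bbR_bound (a : ℝ) (ha : 0 < a) (ha1 : a ≤ 1) (k M : ℕ) (C K : ℝ) (hC : 0 ≤ C)
    (hB : ∀ x ∈ Set.Icc (0 : ℝ) 1, |bbB k x| ≤ C)
    (hK : ∀ N : ℝ, 1 ≤ N → ∫ x in (1 : ℝ)..N, |bbG k k x| ≤ K) :
    |bbR a k k M| ≤ C * K := by
  have ii : ∀ c d : ℝ, 0 < c → 0 < d →
      IntervalIntegrable (fun x => |bbG k k x|) MeasureTheory.volume c d := fun c d hc hd =>
    (bbG_contOn k k c d hc hd).abs.intervalIntegrable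
  have key : ∀ e c d : ℝ, 0 < c → c ≤ d → e ≤ c → d ≤ e + 1 →
      |∫ x in c..d, bbB k (x - e) * bbG k k x| ≤ C * ∫ x in c..d, |bbG k k x| := by
    intro e c d hc hcd hec hde
    rw [← intervalIntegral.integral_const_mul, ← Real.norm_eq_abs]
    refine intervalIntegral.norm_integral_le_of_norm_le hcd ?_
      ((ii c d hc (by linarith)).const_mul C)
    refine Eventually.of_forall fun x hx => ?_
    rw [Real.norm_eq_abs, abs_mul]
    exact mul_le_mul_of_nonneg_right
      (hB _ ⟨by linarith [hx.1], by linarith [hx.2]⟩) (abs_nonneg _)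
  have main : |bbR a k k M| ≤ C * ∫ x in (1 : ℝ)..((M : ℝ) + 1 + a), |bbG k k x| := by
    induction M with
    | zero =>
      simp only [bbR, Finset.range_zero, Finset.sum_empty, add_zero, Nat.cast_zero, zero_add]
      exact key a 1 (1 + a) one_pos (by linarith) ha1 (by linarith)
    | succ M ih =>
      have e : bbR a k k (M + 1) = bbR a k k M +
        ∫ x in ((M : ℝ) + 1 + a)..((M : ℝ) + 1 + a + 1),
        bbB k (x - ((M : ℝ) + 1 + a)) * bbG k k x := by
        simp only [bbR, Finset.sum_range_succ]; ring
      have h2 := key ((M : ℝ) + 1 + a) ((M : ℝ) + 1 + a) ((M : ℝ) + 1 + a + 1) (by positivity)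
        (by linarith) le_rfl le_rfl
      have h3 := intervalIntegral.integral_add_adjacent_intervals
        (ii 1 ((M : ℝ) + 1 + a) one_pos (by positivity))
        (ii ((M : ℝ) + 1 + a) ((M : ℝ) + 1 + a + 1) (by positivity) (by positivity))
      rw [e]
      push_cast
      rw [show (M : ℝ) + 1 + 1 + a = (M : ℝ) + 1 + a + 1 by ring, ← h3, mul_add]
      exact (abs_add_le _ _).trans (add_le_add ih h2)
  refine main.trans (mul_le_mul_of_nonneg_left (hK _ ?_) hC)
  have : (0 : ℝ) ≤ M := Nat.cast_nonneg M
  linarith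

lemma bbR_asymp (a : ℝ) (ha : 0 < a) (k n : ℕ) (hn : n + 1 ≤ k) :
    Tendsto (fun M => |bbR a k 1 M| - |bbR a k (n + 1) M|) atTop (𝓝 0) := by
  induction n with
  | zero => simp
  | succ n ih =>
    have h1 := ih (by omega)
    have h2 : Tendsto (fun M => |bbR a k (n + 1) M| - |bbR a k (n + 1 + 1) M|) atTop (𝓝 0) := by
      have h3 := ((bbG_tendsto k (n + 1) a).const_mul (bbB (n + 1 + 1) 0)).abs
      simp only [mul_zero, abs_zero] at h3
      refine squeeze_zero_norm (fun M => ?_) h3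
      have := bbR_step a ha k (n + 1) M (by omega) (by omega)
      rw [Real.norm_eq_abs]
      have h4 := abs_abs_sub_abs_le_abs_sub (bbR a k (n + 1) M) (-bbR a k (n + 1 + 1) M)
      rw [abs_neg] at h4
      refine h4.trans (le_of_eq ?_)
      rw [this]; congr 1; ring
    simpa using h1.add h2

lemma bb_main (a : ℝ) (ha : 0 < a) (ha1 : a ≤ 1) (k : ℕ) (hk : 1 ≤ k) (L : ℝ)
    (hL : Tendsto (fun M : ℕ =>
        (∑ m ∈ Finset.range (M + 1),
          (Real.log ((m : ℝ) + a)) ^ k / ((m : ℝ) + a))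
        - (Real.log ((M : ℝ) + a)) ^ (k + 1) / (k + 1))
      atTop (𝓝 L)) (C K : ℝ) (hC : 0 ≤ C)
    (hB : ∀ x ∈ Set.Icc (0 : ℝ) 1, |bbB k x| ≤ C)
    (hK : ∀ N : ℝ, 1 ≤ N → ∫ x in (1 : ℝ)..N, |bbG k k x| ≤ K) :
    |L - Real.log a ^ k / a| ≤ C * K := by
  have h1 := (tendsto_add_atTop_iff_nat 1).2 hL
  have h2 : Tendsto (fun M : ℕ => bbG k 0 ((M : ℝ) + 1 + a) / 2 + bbR a k 1 M) atTop
      (𝓝 (L - Real.log a ^ k / a)) := by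
    refine (h1.sub_const (Real.log a ^ k / a)).congr fun M => ?_
    have e1 := bbR_zero a ha k M hk
    rw [bbR_zero_eq a ha] at e1
    rw [Finset.sum_range_succ']
    have e2 : ∑ m ∈ Finset.range (M + 1), Real.log (((m + 1 : ℕ) : ℝ) + a) ^ k / (((m + 1 : ℕ) : ℝ) + a)
        = ∑ m ∈ Finset.range (M + 1), bbG k 0 ((m : ℝ) + 1 + a) := by
      refine Finset.sum_congr rfl fun m _ => ?_
      simp [bbG, bbQ, div_eq_mul_inv]
    rw [e2]
    push_cast
    rw [zero_add]
    linarith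
  have h3 : Tendsto (fun M : ℕ => bbR a k 1 M) atTop (𝓝 (L - Real.log a ^ k / a)) := by
    have := h2.sub ((bbG_tendsto k 0 a).div_const 2)
    simpa using this
  obtain ⟨n, rfl⟩ : ∃ n, k = n + 1 := ⟨k - 1, by omega⟩
  have h4 := h3.abs.sub (bbR_asymp a ha (n + 1) n le_rfl)
  simp only [sub_zero, sub_sub_cancel] at h4
  exact le_of_tendsto' h4 fun M => bbR_bound a ha ha1 (n + 1) M C K hC hB hK

lemma bbB_bound (k : ℕ) (hk : 2 ≤ k) (x : ℝ) (hx : x ∈ Set.Icc (0 : ℝ) 1) :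
    |bbB k x| ≤ (Real.pi ^ 2 / 3) / (2 * Real.pi) ^ k := by
  have h := hasSum_one_div_nat_pow_mul_fourier hk hx
  have h2 : HasSum (fun n : ℕ => 2 * ((1 : ℝ) / (n : ℝ) ^ 2)) (Real.pi ^ 2 / 3) := by
    have := hasSum_zeta_two.mul_left 2
    rwa [show 2 * (Real.pi ^ 2 / 6) = Real.pi ^ 2 / 3 by ring] at this
  have h3 := h.norm_le_of_bounded h2 (fun n => by
    rw [norm_mul]
    have f1 : ‖(fourier (n : ℤ) (x : UnitAddCircle) + (-1 : ℂ) ^ k * fourier (-(n : ℤ)) (x : UnitAddCircle))‖ ≤ 2 := by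
      refine (norm_add_le _ _).trans ?_
      rw [norm_mul, norm_pow, norm_neg, norm_one, one_pow, one_mul]
      rw [fourier_apply, fourier_apply, Circle.norm_coe, Circle.norm_coe]
      norm_num
    have f2 : ‖(1 : ℂ) / (n : ℂ) ^ k‖ ≤ 1 / (n : ℝ) ^ 2 := by
      rw [norm_div, norm_one, norm_pow, Complex.norm_natCast]
      rcases Nat.eq_zero_or_pos n with rfl | hn
      · simp [show k ≠ 0 by omega]
      · have : (1 : ℝ) ≤ n := by exact_mod_cast hn
        gcongr
    calc _ ≤ 1 / (n : ℝ) ^ 2 * 2 := by gcongr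
      _ = _ := by ring)
  rw [norm_mul, norm_div, norm_neg, norm_pow, norm_mul, norm_mul, Complex.norm_I] at h3
  simp only [Complex.norm_real, Complex.norm_natCast, Complex.norm_ofNat, Real.norm_eq_abs, mul_one,
    abs_of_pos Real.pi_pos] at h3
  rw [le_div_iff₀ (by positivity), bbB, abs_div, Nat.abs_cast]
  refine le_trans (le_of_eq ?_) h3
  ring

lemma bb_logint (k : ℕ) (hk : 1 ≤ k) (N : ℝ) (hN : 1 ≤ N) (j : ℕ) :
    ∫ x in (1 : ℝ)..N, Real.log x ^ j * (x ^ (k + 1))⁻¹ ≤ (j.factorial : ℝ) / (k : ℝ) ^ (j + 1) := by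
  have hk0 : (0 : ℝ) < k := by exact_mod_cast hk
  have pos : ∀ x ∈ Set.uIcc 1 N, 0 < x := fun x hx =>
    lt_of_lt_of_le (lt_min one_pos (by linarith)) hx.1
  have ct : ∀ j : ℕ, ContinuousOn (fun x : ℝ => Real.log x ^ j * (x ^ (k + 1))⁻¹)
      (Set.uIcc 1 N) := by
    intro j x hx
    have := pos x hx
    exact (((Real.continuousAt_log this.ne').pow j).mul
      ((continuousAt_id.pow (k + 1)).inv₀ (pow_pos this _).ne')).continuousWithinAt
  have N0 : 0 < N := by linarith
  have lN : 0 ≤ Real.log N := Real.log_nonneg hN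
  induction j with
  | zero =>
    have : ∫ x in (1 : ℝ)..N, Real.log x ^ 0 * (x ^ (k + 1))⁻¹ =
        -(N ^ k)⁻¹ / k - -((1 : ℝ) ^ k)⁻¹ / k := by
      refine intervalIntegral.integral_eq_sub_of_hasDerivAt (f := fun x : ℝ => -(x ^ k)⁻¹ / k) ?_
        (ct 0).intervalIntegrable
      intro x hx
      have hx0 := pos x hx
      refine ((((hasDerivAt_pow k x).inv (pow_pos hx0 _).ne').neg).div_const (k : ℝ)).congr_deriv ?_
      obtain ⟨m, rfl⟩ : ∃ m, k = m + 1 := ⟨k - 1, by omega⟩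
      simp only [Nat.add_sub_cancel]
      field_simp
      ring
    rw [this]
    have : 0 ≤ (N ^ k)⁻¹ / k := by positivity
    simp only [one_pow, inv_one, Nat.factorial_zero, Nat.cast_one, zero_add, pow_one, neg_div]
    linarith
  | succ j ih =>
    have : ∫ x in (1 : ℝ)..N, (Real.log x ^ (j + 1) * (x ^ (k + 1))⁻¹ -
        ((j : ℝ) + 1) / k * (Real.log x ^ j * (x ^ (k + 1))⁻¹)) =
        -(Real.log N ^ (j + 1) * (N ^ k)⁻¹) / k - -(Real.log 1 ^ (j + 1) * ((1 : ℝ) ^ k)⁻¹) / k := by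
      refine intervalIntegral.integral_eq_sub_of_hasDerivAt
        (f := fun x : ℝ => -(Real.log x ^ (j + 1) * (x ^ k)⁻¹) / k) ?_
        ((ct (j + 1)).sub ((ct j).const_mul _)).intervalIntegrable
      intro x hx
      have hx0 := pos x hx
      refine (((((Real.hasDerivAt_log hx0.ne').pow (j + 1)).mul
        ((hasDerivAt_pow k x).inv (pow_pos hx0 _).ne')).neg).div_const (k : ℝ)).congr_deriv ?_
      obtain ⟨m, rfl⟩ : ∃ m, k = m + 1 := ⟨k - 1, by omega⟩
      simp only [Nat.add_sub_cancel, Pi.inv_apply, Pi.pow_apply]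
      push_cast
      field_simp
      ring
    rw [intervalIntegral.integral_sub (ct (j + 1)).intervalIntegrable
      ((ct j).const_mul _).intervalIntegrable, intervalIntegral.integral_const_mul] at this
    have p : 0 ≤ (Real.log N ^ (j + 1) * (N ^ k)⁻¹) / k := by positivity
    rw [neg_div, Real.log_one] at this
    have q : ((j : ℝ) + 1) / k * ∫ x in (1 : ℝ)..N, Real.log x ^ j * (x ^ (k + 1))⁻¹ ≤
      ((j : ℝ) + 1) / k * ((j.factorial : ℝ) / (k : ℝ) ^ (j + 1)) :=
      mul_le_mul_of_nonneg_left ih (by positivity)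
    have r : ((j : ℝ) + 1) / k * ((j.factorial : ℝ) / (k : ℝ) ^ (j + 1)) =
      ((j + 1).factorial : ℝ) / (k : ℝ) ^ (j + 1 + 1) := by
      rw [Nat.factorial_succ]; push_cast; field_simp; ring
    rw [← r]
    simp at this
    linarith

noncomputable def bbPhi (k n : ℕ) : ℝ :=
  ∑ j ∈ Finset.range (k + 1), |(bbQ k n).coeff j| * ((j.factorial : ℝ) / (k : ℝ) ^ (j + 1))

lemma bbPhi_succ (k n : ℕ) (hk : 1 ≤ k) : bbPhi k (n + 1) ≤ ((k : ℝ) + n + 1) * bbPhi k n := by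
  have hk0 : (0 : ℝ) < k := by exact_mod_cast hk
  have h1 : bbPhi k (n + 1) ≤ (∑ j ∈ Finset.range (k + 1),
      k * (|(bbQ k n).coeff (j + 1)| * (((j + 1).factorial : ℝ) / (k : ℝ) ^ (j + 1 + 1)))) +
      ((n : ℝ) + 1) * bbPhi k n := by
    rw [bbPhi, bbPhi, Finset.mul_sum, ← Finset.sum_add_distrib]
    refine Finset.sum_le_sum fun j _ => ?_
    rw [bbQ_coeff_succ]
    have := abs_sub (Polynomial.coeff (bbQ k n) (j + 1) * ((j : ℝ) + 1))
      (((n : ℝ) + 1) * (bbQ k n).coeff j)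
    rw [abs_mul, abs_mul, abs_of_pos (show (0 : ℝ) < (j : ℝ) + 1 by positivity),
      abs_of_pos (show (0 : ℝ) < (n : ℝ) + 1 by positivity)] at this
    refine (mul_le_mul_of_nonneg_right this (by positivity)).trans (le_of_eq ?_)
    rw [Nat.factorial_succ]; push_cast; field_simp; ring
  have h2 : (∑ j ∈ Finset.range (k + 1),
      (|(bbQ k n).coeff (j + 1)| * (((j + 1).factorial : ℝ) / (k : ℝ) ^ (j + 1 + 1)))) ≤
      bbPhi k n := by
    have := Finset.sum_range_succ' (fun j => |(bbQ k n).coeff j| * ((j.factorial : ℝ) / (k : ℝ) ^ (j + 1))) (k + 1)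
    rw [Finset.sum_range_succ, bbQ_coeff_high k n (k + 1) (by omega)] at this
    have p : 0 ≤ |(bbQ k n).coeff 0| * ((Nat.factorial 0 : ℝ) / (k : ℝ) ^ (0 + 1)) := by positivity
    simp only [abs_zero, zero_mul, add_zero] at this
    rw [bbPhi]
    linarith
  rw [← Finset.mul_sum] at h1
  nlinarith

lemma bbPhi_bound (k n : ℕ) (hk : 1 ≤ k) :
    bbPhi k n ≤ ((k + 1).ascFactorial n : ℝ) * ((k.factorial : ℝ) / (k : ℝ) ^ (k + 1)) := by
  induction n with
  | zero =>
    simp only [bbPhi, bbQ, Polynomial.coeff_X_pow]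
    rw [Finset.sum_eq_single k]
    · simp
    · intro j _ hj; simp [hj]
    · simp
  | succ n ih =>
    refine (bbPhi_succ k n hk).trans ?_
    refine (mul_le_mul_of_nonneg_left ih (by positivity)).trans (le_of_eq ?_)
    rw [Nat.ascFactorial_succ]; push_cast; ring

lemma bbG_int (k : ℕ) (hk : 1 ≤ k) (N : ℝ) (hN : 1 ≤ N) :
    ∫ x in (1 : ℝ)..N, |bbG k k x| ≤ bbPhi k k := by
  have pos : ∀ x ∈ Set.uIcc 1 N, 0 < x := fun x hx =>
    lt_of_lt_of_le (lt_min one_pos (by linarith)) hx.1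
  have ct : ∀ j : ℕ, ContinuousOn (fun x : ℝ => |(bbQ k k).coeff j| * (Real.log x ^ j * (x ^ (k + 1))⁻¹))
      (Set.uIcc 1 N) := by
    intro j x hx
    have := pos x hx
    exact (continuousAt_const.mul (((Real.continuousAt_log this.ne').pow j).mul
      ((continuousAt_id.pow (k + 1)).inv₀ (pow_pos this _).ne'))).continuousWithinAt
  calc ∫ x in (1 : ℝ)..N, |bbG k k x| ≤ ∫ x in (1 : ℝ)..N, ∑ j ∈ Finset.range (k + 1),
        |(bbQ k k).coeff j| * (Real.log x ^ j * (x ^ (k + 1))⁻¹) := by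
        refine intervalIntegral.integral_mono_on hN
          (bbG_contOn k k 1 N one_pos (by linarith)).abs.intervalIntegrable
          (continuousOn_finsetSum _ fun j _ => ct j).intervalIntegrable ?_
        intro x hx
        have hx0 : 0 < x := by linarith [hx.1]
        have hl : 0 ≤ Real.log x := Real.log_nonneg hx.1
        rw [bbG, bbQ_eval, Finset.sum_mul]
        refine (Finset.abs_sum_le_sum_abs _ _).trans (Finset.sum_le_sum fun j _ => ?_)
        rw [abs_mul, abs_mul, abs_of_nonneg (pow_nonneg hl j),
          abs_of_pos (show 0 < (x ^ (k + 1))⁻¹ by positivity), mul_assoc]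
    _ = ∑ j ∈ Finset.range (k + 1), |(bbQ k k).coeff j| *
        ∫ x in (1 : ℝ)..N, Real.log x ^ j * (x ^ (k + 1))⁻¹ := by
        rw [intervalIntegral.integral_finsetSum fun j _ => (ct j).intervalIntegrable]
        simp only [intervalIntegral.integral_const_mul]
    _ ≤ bbPhi k k := by
        refine Finset.sum_le_sum fun j _ => ?_
        exact mul_le_mul_of_nonneg_left (bb_logint k hk N hN j) (abs_nonneg _)

lemma bbG_int_one (N : ℝ) (hN : 1 ≤ N) : ∫ x in (1 : ℝ)..N, |bbG 1 1 x| ≤ 1 := by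
  have pos : ∀ x ∈ Set.uIcc 1 N, 0 < x := fun x hx =>
    lt_of_lt_of_le (lt_min one_pos (by linarith)) hx.1
  have ct : ContinuousOn (fun x : ℝ => (1 - Real.log x + Real.log x ^ 2 / 2) * (x ^ 2)⁻¹)
      (Set.uIcc 1 N) := by
    intro x hx
    have := pos x hx
    have hl := Real.continuousAt_log this.ne'
    exact (((continuousAt_const.sub hl).add ((hl.pow 2).div_const 2)).mul
      ((continuousAt_id.pow 2).inv₀ (pow_pos this _).ne')).continuousWithinAt
  have N0 : 0 < N := by linarith
  calc ∫ x in (1 : ℝ)..N, |bbG 1 1 x| ≤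
      ∫ x in (1 : ℝ)..N, (1 - Real.log x + Real.log x ^ 2 / 2) * (x ^ 2)⁻¹ := by
        refine intervalIntegral.integral_mono_on hN
          (bbG_contOn 1 1 1 N one_pos (by linarith)).abs.intervalIntegrable
          ct.intervalIntegrable ?_
        intro x hx
        have hx0 : 0 < x := by linarith [hx.1]
        rw [bbG, abs_mul, abs_of_pos (show 0 < (x ^ (1 + 1))⁻¹ by positivity)]
        refine mul_le_mul_of_nonneg_right ?_ (by positivity)
        simp [bbQ]
        rw [abs_le]
        constructor <;> nlinarith [sq_nonneg (Real.log x), sq_nonneg (Real.log x - 2)]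
    _ = -(1 + Real.log N ^ 2 / 2) * N⁻¹ - -(1 + Real.log 1 ^ 2 / 2) * 1⁻¹ := by
        refine intervalIntegral.integral_eq_sub_of_hasDerivAt
          (f := fun x : ℝ => -(1 + Real.log x ^ 2 / 2) * x⁻¹) ?_ ct.intervalIntegrable
        intro x hx
        have hx0 := pos x hx
        refine (((((Real.hasDerivAt_log hx0.ne').pow 2).div_const 2).const_add 1).neg.mul
          (hasDerivAt_inv hx0.ne')).congr_deriv ?_
        simp only [Pi.neg_apply, Pi.pow_apply]
        field_simp
        ring
    _ ≤ 1 := by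
        have : 0 ≤ (1 + Real.log N ^ 2 / 2) * N⁻¹ := by positivity
        simp at this ⊢
        linarith

lemma bb_asc (k : ℕ) (hk : 3 ≤ k) :
    ((k + 1).ascFactorial k : ℝ) ≤ 9 / 16 * (2 * (k : ℝ)) ^ k := by
  obtain ⟨m, rfl⟩ : ∃ m, k = m + 3 := ⟨k - 3, by omega⟩
  have e : ((m + 3 + 1).ascFactorial (m + 3) : ℝ) =
      ((m : ℝ) + 3 + 1) * (2 * m + 5) * (2 * m + 6) * ((m + 3 + 2).ascFactorial m : ℝ) := by
    have h : (m + 3 + 1).ascFactorial (m + 3) =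
      (m + 3 + 1) * (2 * m + 5) * (2 * m + 6) * ((m + 3 + 2).ascFactorial m) := by
      rw [Nat.ascFactorial_succ, Nat.ascFactorial_succ]
      have := Nat.succ_ascFactorial (m + 3 + 1) m
      have h2 : (m + 3 + 1).ascFactorial (m + 1) = (m + 3 + 1) * (m + 3 + 2).ascFactorial m := by
        rw [Nat.ascFactorial_succ, ← this]
      rw [h2]; ring
    rw [h]; push_cast; ring
  have h1 : ((m + 3 + 2).ascFactorial m : ℝ) ≤ (2 * ((m : ℝ) + 3)) ^ m := by
    have h := Nat.ascFactorial_le_pow_add (m + 3 + 1) m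
    have h' : ((m + 3 + 2).ascFactorial m : ℝ) ≤ ((m : ℝ) + 3 + 1 + m) ^ m := by exact_mod_cast h
    refine h'.trans ?_
    gcongr
    linarith
  rw [e]
  push_cast
  have h2 : ((m : ℝ) + 3 + 1) * (2 * m + 5) * (2 * m + 6) ≤ 9 / 16 * (2 * ((m : ℝ) + 3)) ^ 3 := by
    have : (0 : ℝ) ≤ m := Nat.cast_nonneg m
    nlinarith [mul_nonneg this this, pow_nonneg this 3]
  calc _ ≤ (9 / 16 * (2 * ((m : ℝ) + 3)) ^ 3) * (2 * ((m : ℝ) + 3)) ^ m := by gcongr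
    _ = _ := by ring

theorem berndt_bound_generalized_stieltjes
    (a : ℝ) (ha : 0 < a) (ha1 : a ≤ 1) (k : ℕ) (hk : 1 ≤ k)
    (L : ℝ)
    (hL : Tendsto (fun M : ℕ =>
        (∑ m ∈ Finset.range (M + 1),
          (Real.log ((m : ℝ) + a)) ^ k / ((m : ℝ) + a))
        - (Real.log ((M : ℝ) + a)) ^ (k + 1) / (k + 1))
      atTop (𝓝 L)) :
    |((-1 : ℝ) ^ k / (k.factorial : ℝ)) * L
        - (-1 : ℝ) ^ k * (Real.log a) ^ k / (a * (k.factorial : ℝ))|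
      ≤ (3 + (-1 : ℝ) ^ k) / (k * Real.pi ^ k) := by
  have hpi := Real.pi_pos
  have hk0 : (0 : ℝ) < k := by exact_mod_cast hk
  have hf : (0 : ℝ) < (k.factorial : ℝ) := by exact_mod_cast k.factorial_pos
  have e : ((-1 : ℝ) ^ k / (k.factorial : ℝ)) * L
        - (-1 : ℝ) ^ k * (Real.log a) ^ k / (a * (k.factorial : ℝ)) =
      (-1 : ℝ) ^ k * ((L - Real.log a ^ k / a) / (k.factorial : ℝ)) := by
    field_simp
  rw [e, abs_mul, abs_pow, abs_neg, abs_one, one_pow, one_mul, abs_div, abs_of_pos hf]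
  rcases Nat.lt_or_ge k 2 with h | h
  · obtain rfl : k = 1 := by omega
    have := bb_main a ha ha1 1 hk L hL (1 / 2) 1 (by norm_num)
      (fun x hx => by
        simp [bbB]; rw [abs_le]; constructor <;> linarith [hx.1, hx.2])
      bbG_int_one
    have h4 : (1 / 2 : ℝ) ≤ 2 / Real.pi := by
      rw [div_le_div_iff₀ (by norm_num) hpi]; linarith [Real.pi_le_four]
    simp only [pow_one, Nat.factorial_one, Nat.cast_one, div_one, one_mul] at this ⊢
    norm_num at this ⊢
    linarith
  · have := bb_main a ha ha1 k hk L hL _ _ (by positivity) (bbB_bound k h)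
      (fun N hN => (bbG_int k hk N hN).trans (bbPhi_bound k k hk))
    have key : Real.pi ^ 2 / 3 * ((k + 1).ascFactorial k : ℝ) ≤
        (3 + (-1 : ℝ) ^ k) * (2 * (k : ℝ)) ^ k := by
      have hp : Real.pi ^ 2 < 10 := by
        have := Real.pi_lt_d2
        nlinarith
      have hP : (0 : ℝ) < (2 * (k : ℝ)) ^ k := by positivity
      rcases Nat.lt_or_ge k 3 with h3 | h3
      · obtain rfl : k = 2 := by omega
        norm_num [Nat.ascFactorial]
        nlinarith
      · have h5 := bb_asc k h3
        have h6 : (2 : ℝ) ≤ 3 + (-1 : ℝ) ^ k := by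
          rcases neg_one_pow_eq_or ℝ k with h | h <;> rw [h] <;> norm_num
        calc _ ≤ Real.pi ^ 2 / 3 * (9 / 16 * (2 * (k : ℝ)) ^ k) := by gcongr
          _ ≤ 2 * (2 * (k : ℝ)) ^ k := by nlinarith
          _ ≤ _ := by gcongr
    rw [div_le_iff₀ hf]
    refine this.trans ?_
    calc _ = (Real.pi ^ 2 / 3 * ((k + 1).ascFactorial k : ℝ)) *
          ((k.factorial : ℝ) / ((2 * Real.pi) ^ k * (k : ℝ) ^ (k + 1))) := by
          field_simp
      _ ≤ ((3 + (-1 : ℝ) ^ k) * (2 * (k : ℝ)) ^ k) *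
          ((k.factorial : ℝ) / ((2 * Real.pi) ^ k * (k : ℝ) ^ (k + 1))) := by gcongr
      _ = _ := by
          rw [mul_pow, mul_pow, pow_succ]
          field_simp
end

section
/- For α, v, w > 0 and every natural number k, the Laurent coefficients of the Barnes double zeta-function at s = 1 and s = 2 satisfy ∑_{l=−1}^{k} (−1)^{k−l+1} ∂/∂α γ_l(1, α; v, w) = γ_k(2, α; v, w). -/
open Filter Topology Finset



/-- Identity theorem for meromorphic functions. -/
lemma bz_identity {f g : ℂ → ℂ} {U : Set ℂ} (hf : MeromorphicOn f U) (hg : MeromorphicOn g U)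
    (hU : IsConnected U) {x y : ℂ} (hx : x ∈ U) (hy : y ∈ U)
    (h : ∀ᶠ s in 𝓝[≠] x, f s = g s) : ∀ᶠ s in 𝓝[≠] y, f s = g s := by
  have hm : MeromorphicOn (f - g) U := hf.sub hg
  have h1 : meromorphicOrderAt (f - g) x = ⊤ := by
    rw [meromorphicOrderAt_eq_top_iff]
    filter_upwards [h] with s hs
    simp [hs]
  have h2 : meromorphicOrderAt (f - g) y = ⊤ := by
    by_contra hne
    exact (hm.exists_meromorphicOrderAt_ne_top_iff_forall hU).1 ⟨⟨y, hy⟩, hne⟩ ⟨x, hx⟩ h1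
  rw [meromorphicOrderAt_eq_top_iff] at h2
  filter_upwards [h2] with s hs
  exact sub_eq_zero.1 hs

/-- Laurent coefficients as circle integrals. -/
lemma bz_laurent {f : ℂ → ℂ} {c : ℂ} {R R' : ℝ} (hR : 0 < R) (hRR : R < R')
    (hf : ∀ s ∈ Metric.ball c R', s ≠ c → DifferentiableAt ℂ f s) (γ : ℤ → ℂ)
    (hγ : ∀ᶠ s in 𝓝[≠] c, f s = γ (-1) / (s - c) + ∑' k : ℕ, γ (k : ℤ) * (s - c) ^ k)
    (hne : ∀ d : ℂ, ¬ ∀ᶠ s in 𝓝[≠] c, f s = d / (s - c)) :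
    (∀ n : ℕ, (∮ s in C(c, R), f s * ((s - c) ^ n)⁻¹) = 2 * Real.pi * Complex.I * γ (n - 1)) ∧
      (∮ s in C(c, R), f s * (s - c)) = 0 := by
  classical
  obtain ⟨r, hr, hγ'⟩ := Metric.eventually_nhds_iff.1 (eventually_nhdsWithin_iff.1 hγ)
  -- a point where the series converges
  obtain ⟨s₀, hs₀, hsum⟩ : ∃ s₀ : ℂ, s₀ ≠ c ∧ Summable fun k : ℕ => γ (k : ℤ) * (s₀ - c) ^ k := by
    by_contra hcon
    push Not at hcon
    refine hne (γ (-1)) ?_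
    filter_upwards [hγ, self_mem_nhdsWithin] with s hs hsc
    rw [hs, tsum_eq_zero_of_not_summable (hcon s hsc), add_zero]
  have hρ : 0 < ‖s₀ - c‖ := norm_pos_iff.2 (sub_ne_zero.2 hs₀)
  have hsumm : ∀ z : ℂ, ‖z‖ < ‖s₀ - c‖ → Summable fun k : ℕ => γ (k : ℤ) * z ^ k := by
    intro z hz
    obtain ⟨C, hC⟩ := hsum.tendsto_atTop_zero.norm.bddAbove_range
    have hq : ‖z‖ / ‖s₀ - c‖ < 1 := (div_lt_one hρ).2 hz
    refine Summable.of_norm_bounded (g := fun k : ℕ => C * (‖z‖ / ‖s₀ - c‖) ^ k)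
      ((summable_geometric_of_lt_one (by positivity) hq).mul_left C) fun k => ?_
    have h1 : ‖γ (k : ℤ) * (s₀ - c) ^ k‖ ≤ C := hC ⟨k, rfl⟩
    rw [norm_mul, norm_pow] at h1 ⊢
    calc ‖γ (k : ℤ)‖ * ‖z‖ ^ k
        = (‖γ (k : ℤ)‖ * ‖s₀ - c‖ ^ k) * (‖z‖ / ‖s₀ - c‖) ^ k := by
          rw [div_pow]; field_simp
      _ ≤ _ := by gcongr
  set H : ℂ → ℂ := Function.update (fun s => (s - c) * f s) c (γ (-1)) with hH
  have hHne : ∀ s, s ≠ c → H s = (s - c) * f s := fun s hs => by simp [hH, hs]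
  set p : FormalMultilinearSeries ℂ ℂ ℂ :=
    FormalMultilinearSeries.ofScalars ℂ (fun n : ℕ => γ ((n : ℤ) - 1)) with hp
  have hcoeff : ∀ n, p.coeff n = γ ((n : ℤ) - 1) := fun n => by
    simp [hp, FormalMultilinearSeries.coeff_ofScalars]
  have hps : HasFPowerSeriesAt H p c := by
    rw [hasFPowerSeriesAt_iff, Metric.eventually_nhds_iff]
    refine ⟨min r ‖s₀ - c‖, lt_min hr hρ, fun z hz => ?_⟩
    rw [dist_zero_right] at hz
    simp only [hcoeff, smul_eq_mul]
    rw [← hasSum_nat_add_iff' 1]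
    simp only [Finset.sum_range_one, pow_zero, one_mul, Nat.cast_zero, zero_sub]
    have h1 := ((hsumm z (hz.trans_le (min_le_right _ _))).hasSum).mul_left z
    convert! h1 using 1
    · ext n
      push_cast
      rw [add_sub_cancel_right]; ring
    · by_cases hz0 : z = 0
      · simp [hz0, hH]
      · have hzc : c + z ≠ c := by simpa using hz0
        rw [hHne _ hzc, hγ' (y := c + z) (by simpa [dist_eq_norm] using hz.trans_le (min_le_left _ _)) hzc]
        simp only [add_sub_cancel_left]
        field_simp
        ring
  have hHd : ∀ s ∈ Metric.ball c R', DifferentiableAt ℂ H s := by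
    intro s hs
    by_cases hsc : s = c
    · rw [hsc]; exact hps.analyticAt.differentiableAt
    · have h1 : DifferentiableAt ℂ (fun s => (s - c) * f s) s :=
        (differentiableAt_id.sub_const c).mul (hf s hs hsc)
      refine h1.congr_of_eventuallyEq ?_
      filter_upwards [isOpen_ne.mem_nhds hsc] with y hy
      exact hHne y hy
  have hcb : Metric.closedBall c R ⊆ Metric.ball c R' := Metric.closedBall_subset_ball hRR
  have hdo : DifferentiableOn ℂ H (Metric.closedBall c R) := fun s hs =>
    (hHd s (hcb hs)).differentiableWithinAt
  have hsph : ∀ s ∈ Metric.sphere c R, s ≠ c := fun s hs h => by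
    rw [h] at hs; simp at hs; exact hR.ne hs
  refine ⟨fun n => ?_, ?_⟩
  · have h2 := (DifferentiableOn.hasFPowerSeriesOnBall (R := ⟨R, hR.le⟩) hdo hR).hasFPowerSeriesAt
    have h3 := hps.eq_formalMultilinearSeries h2
    have h4 : p.coeff n = (cauchyPowerSeries H c R n) fun _ => 1 := by
      rw [h3]; rfl
    rw [hcoeff, cauchyPowerSeries_apply, smul_eq_mul] at h4
    rw [h4, ← mul_assoc, mul_inv_cancel₀ Complex.two_pi_I_ne_zero, one_mul]
    refine circleIntegral.integral_congr hR.le fun s hs => ?_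
    have h5 := sub_ne_zero.2 (hsph s hs)
    simp only [smul_eq_mul, hHne s (hsph s hs), one_div, inv_pow]
    field_simp
  · rw [← Complex.circleIntegral_eq_zero_of_differentiable_on_off_countable hR.le
      (s := ∅) Set.countable_empty hdo.continuousOn
      (fun z hz => hHd z (hcb (Metric.ball_subset_closedBall hz.1)))]
    refine circleIntegral.integral_congr hR.le fun s hs => ?_
    simp only [hHne s (hsph s hs)]
    ring



noncomputable def bzG (x : ℝ) : ℝ := 1 / (1 - Real.exp (-x)) - 1 / x - 1 / 2

lemma bzG_bound {x : ℝ} (hx : 0 < x) : |bzG x| ≤ 3 * x ∧ |bzG x| ≤ 3 := by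
  unfold bzG
  rcases le_or_gt x 1 with h1 | h1
  · have hb := Real.exp_bound (x := -x) (by rw [abs_neg, abs_of_pos hx]; exact h1) (n := 3) (by norm_num)
    simp only [Finset.sum_range_succ, Finset.sum_range_zero, abs_neg, abs_of_pos hx] at hb
    norm_num [Nat.factorial] at hb
    obtain ⟨hb1, hb2⟩ := abs_le.1 hb
    set D := 1 - Real.exp (-x) with hD
    have hDx : 5 / 18 * x ≤ D := by nlinarith [mul_pos hx hx, pow_pos hx 3]
    have hD0 : 0 < D := by nlinarith
    have hk : |1 / D - 1 / x - 1 / 2| ≤ 3 * x := by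
      have e : 1 / D - 1 / x - 1 / 2 = (2 * x - 2 * D - x * D) / (2 * x * D) := by
        field_simp
      rw [e, abs_div, abs_of_pos (by positivity : 0 < 2 * x * D), div_le_iff₀ (by positivity)]
      have : 3 * x * (2 * x * D) ≥ 5 / 3 * x ^ 3 := by nlinarith [mul_pos hx hx]
      refine le_trans ?_ this
      have hx3 := pow_pos hx 3
      have hE : D = x - x ^ 2 / 2 - (Real.exp (-x) - (1 + -x + x ^ 2 / 2)) := by rw [hD]; ring
      set θ := Real.exp (-x) - (1 + -x + x ^ 2 / 2)
      have e2 : 2 * x - 2 * D - x * D = x ^ 3 / 2 + (2 + x) * θ := by rw [hE]; ring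
      rw [e2, abs_le]
      constructor <;> nlinarith
    exact ⟨hk, hk.trans (by linarith)⟩
  · have h2 : Real.exp (-x) ≤ 1 / 2 := by
      have := Real.add_one_le_exp x
      rw [Real.exp_neg]
      rw [inv_le_comm₀ (Real.exp_pos _) (by norm_num)]
      norm_num; linarith
    have h3 := Real.exp_pos (-x)
    have h4 : 1 / (1 - Real.exp (-x)) ≤ 2 := by
      rw [div_le_iff₀ (by linarith)]; linarith
    have h5 : 1 ≤ 1 / (1 - Real.exp (-x)) := by
      rw [le_div_iff₀ (by linarith)]; linarith
    have h6 : 1 / x ≤ 1 := by rw [div_le_iff₀ hx]; linarith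
    have h7 : 0 < 1 / x := by positivity
    have : |1 / (1 - Real.exp (-x)) - 1 / x - 1 / 2| ≤ 3 := by
      rw [abs_le]; constructor <;> linarith
    exact ⟨this.trans (by linarith), this⟩

noncomputable def bzh (v w t : ℝ) : ℝ :=
  1 / ((1 - Real.exp (-(v * t))) * (1 - Real.exp (-(w * t)))) - 1 / (v * w) / t ^ 2
    - (1 / v + 1 / w) / 2 / t

lemma bz_one_sub_pos {x : ℝ} (hx : 0 < x) : 0 < 1 - Real.exp (-x) := by
  have : Real.exp (-x) < 1 := by rw [Real.exp_lt_one_iff]; linarith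
  linarith

lemma bzh_bound {v w : ℝ} (hv : 0 < v) (hw : 0 < w) :
    ∃ C : ℝ, 0 < C ∧ ∀ t : ℝ, 0 < t → |bzh v w t| ≤ C := by
  refine ⟨3 * w / v + 3 * v / w + 16, by positivity, fun t ht => ?_⟩
  have hvt : 0 < v * t := by positivity
  have hwt : 0 < w * t := by positivity
  obtain ⟨a1, a2⟩ := bzG_bound hvt
  obtain ⟨b1, b2⟩ := bzG_bound hwt
  have p1 := (bz_one_sub_pos hvt).ne'
  have p2 := (bz_one_sub_pos hwt).ne'
  have e : bzh v w t = bzG (w * t) / (v * t) + bzG (v * t) / (w * t)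
      + (1 / 2 + bzG (v * t)) * (1 / 2 + bzG (w * t)) := by
    unfold bzh bzG
    field_simp
    ring
  have c1 : |bzG (w * t) / (v * t)| ≤ 3 * w / v := by
    rw [abs_div, abs_of_pos hvt, div_le_div_iff₀ hvt hv]
    nlinarith
  have c2 : |bzG (v * t) / (w * t)| ≤ 3 * v / w := by
    rw [abs_div, abs_of_pos hwt, div_le_div_iff₀ hwt hw]
    nlinarith
  have c3 : |(1 / 2 + bzG (v * t)) * (1 / 2 + bzG (w * t))| ≤ 16 := by
    rw [abs_mul]
    have d1 : |1 / 2 + bzG (v * t)| ≤ 4 := by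
      rw [abs_le] at a2 ⊢; constructor <;> linarith
    have d2 : |1 / 2 + bzG (w * t)| ≤ 4 := by
      rw [abs_le] at b2 ⊢; constructor <;> linarith
    calc _ ≤ (4 : ℝ) * 4 := by gcongr
      _ = 16 := by norm_num
  rw [e]
  exact (abs_add_three _ _ _).trans (by linarith)

lemma bzh_cont {v w : ℝ} (hv : 0 < v) (hw : 0 < w) : ContinuousOn (bzh v w) (Set.Ioi 0) := by
  unfold bzh
  intro t ht
  have ht' : 0 < t := ht
  have p1 := (bz_one_sub_pos (mul_pos hv ht')).ne'
  have p2 := (bz_one_sub_pos (mul_pos hw ht')).ne'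
  apply ContinuousAt.continuousWithinAt
  have h3 : t ^ 2 ≠ 0 := by positivity
  fun_prop (disch := first | assumption | positivity)

/-- the integral remainder -/
noncomputable def bzf (v w a : ℝ) (t : ℝ) : ℂ := ((Real.exp (-a * t) * bzh v w t : ℝ) : ℂ)

noncomputable def bzI (v w a : ℝ) (s : ℂ) : ℂ := mellin (bzf v w a) s

lemma bzf_cont {v w a : ℝ} (hv : 0 < v) (hw : 0 < w) : ContinuousOn (bzf v w a) (Set.Ioi 0) := by
  have := bzh_cont hv hw
  unfold bzf
  fun_prop

lemma bzf_locInt {v w a : ℝ} (hv : 0 < v) (hw : 0 < w) :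
    MeasureTheory.LocallyIntegrableOn (bzf v w a) (Set.Ioi 0) :=
  (bzf_cont hv hw).locallyIntegrableOn measurableSet_Ioi

lemma bzf_norm {v w C : ℝ} (hC : ∀ t : ℝ, 0 < t → |bzh v w t| ≤ C) (a : ℝ) {t : ℝ} (ht : 0 < t) :
    ‖bzf v w a t‖ ≤ C * Real.exp (-a * t) := by
  unfold bzf
  rw [Complex.norm_real, Real.norm_eq_abs, abs_mul, abs_of_pos (Real.exp_pos _), mul_comm]
  gcongr
  exact hC t ht

lemma bzf_top {v w a : ℝ} (hv : 0 < v) (hw : 0 < w) :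
    bzf v w a =O[atTop] fun t => Real.exp (-a * t) := by
  obtain ⟨C, hC0, hC⟩ := bzh_bound hv hw
  refine Asymptotics.IsBigO.of_bound C ?_
  filter_upwards [eventually_gt_atTop 0] with t ht
  rw [Real.norm_of_nonneg (Real.exp_pos _).le]
  exact bzf_norm hC a ht

lemma bzf_bot {v w a : ℝ} (ha : 0 < a) (hv : 0 < v) (hw : 0 < w) :
    bzf v w a =O[𝓝[>] 0] fun t => t ^ (-(0 : ℝ)) := by
  obtain ⟨C, hC0, hC⟩ := bzh_bound hv hw
  refine Asymptotics.IsBigO.of_bound C ?_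
  filter_upwards [self_mem_nhdsWithin] with t ht
  have ht' : 0 < t := ht
  refine (bzf_norm hC a ht').trans ?_
  simp only [neg_zero, Real.rpow_zero, norm_one]
  gcongr
  rw [Real.exp_le_one_iff]
  nlinarith

lemma bzI_diff {v w a : ℝ} (ha : 0 < a) (hv : 0 < v) (hw : 0 < w) {s : ℂ} (hs : 0 < s.re) :
    DifferentiableAt ℂ (bzI v w a) s :=
  mellin_differentiableAt_of_isBigO_rpow_exp ha (bzf_locInt hv hw) (bzf_top hv hw)
    (bzf_bot ha hv hw) hs

lemma bzI_conv {v w a : ℝ} (ha : 0 < a) (hv : 0 < v) (hw : 0 < w) {s : ℂ} (hs : 0 < s.re) :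
    MellinConvergent (bzf v w a) s :=
  mellinConvergent_of_isBigO_rpow_exp ha (bzf_locInt hv hw) (bzf_top hv hw)
    (bzf_bot ha hv hw) hs

lemma bz_int_rpow {b σ : ℝ} (hb : 0 < b) (hσ : 0 < σ) :
    MeasureTheory.IntegrableOn (fun t : ℝ => t ^ (σ - 1) * Real.exp (-b * t)) (Set.Ioi 0) := by
  have := integrableOn_rpow_mul_exp_neg_mul_rpow (p := 1) (s := σ - 1) (b := b) (by linarith)
    one_pos hb
  simpa using this

lemma bzI_deriv {v w a : ℝ} (ha : 0 < a) (hv : 0 < v) (hw : 0 < w) {s : ℂ} (hs : 0 < s.re) :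
    HasDerivAt (fun b : ℝ => bzI v w b s) (-bzI v w a (s + 1)) a := by
  obtain ⟨C, hC0, hC⟩ := bzh_bound hv hw
  have key := hasDerivAt_integral_of_dominated_loc_of_deriv_le
    (μ := MeasureTheory.volume.restrict (Set.Ioi (0 : ℝ)))
    (F := fun (b : ℝ) (t : ℝ) => (t : ℂ) ^ (s - 1) • bzf v w b t)
    (F' := fun (b : ℝ) (t : ℝ) => -((t : ℂ) ^ (s + 1 - 1) • bzf v w b t))
    (x₀ := a) (s := Set.Ioi (a / 2))
    (bound := fun t : ℝ => C * (t ^ (s.re + 1 - 1) * Real.exp (-(a / 2) * t)))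
    (Ioi_mem_nhds (by linarith)) ?_ (bzI_conv ha hv hw hs) ?_ ?_
    ((bz_int_rpow (by linarith) (by linarith)).const_mul C) ?_
  · have h2 := key.2
    unfold bzI mellin
    rwa [MeasureTheory.integral_neg] at h2
  · filter_upwards [Ioi_mem_nhds ha] with b hb
    exact (bzI_conv hb hv hw hs).aestronglyMeasurable
  · exact ((bzI_conv ha hv hw (s := s + 1) (by simp; linarith)).aestronglyMeasurable).neg
  · refine (MeasureTheory.ae_restrict_iff' measurableSet_Ioi).2 (.of_forall fun t ht b hb => ?_)
    have ht' : 0 < t := ht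
    have hb' : a / 2 < b := hb
    rw [norm_neg, norm_smul, Complex.norm_cpow_eq_rpow_re_of_pos ht', ← mul_assoc, mul_comm C, mul_assoc]
    have : (s + 1 - 1).re = s.re + 1 - 1 := by simp
    rw [this]
    gcongr
    refine (bzf_norm hC b ht').trans ?_
    gcongr
  · refine (MeasureTheory.ae_restrict_iff' measurableSet_Ioi).2 (.of_forall fun t ht b hb => ?_)
    have ht' : 0 < t := ht
    have h1 : HasDerivAt (fun b : ℝ => Real.exp (-b * t) * bzh v w t)
        (-t * (Real.exp (-b * t) * bzh v w t)) b := by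
      have := (((hasDerivAt_id b).neg.mul_const t).exp).mul_const (bzh v w t)
      convert! this using 1
      simp; ring
    have h2 := (h1.ofReal_comp).const_smul ((t : ℂ) ^ (s - 1))
    convert! h2 using 1
    have h3 : (t : ℂ) ^ (s + 1 - 1) = (t : ℂ) ^ (s - 1) * t := by
      have h4 : s + 1 - 1 = (s - 1) + 1 := by ring
      rw [h4, Complex.cpow_add _ _ (by exact_mod_cast ht'.ne'), Complex.cpow_one]
    rw [h3]
    unfold bzf
    simp only [smul_eq_mul]
    push_cast
    ring

lemma bzI_bdd {v w b σ₀ σ₁ : ℝ} (hb : 0 < b) (hv : 0 < v) (hw : 0 < w) (h0 : 0 < σ₀) (h1 : 0 < σ₁) :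
    ∃ M : ℝ, ∀ a : ℝ, b ≤ a → ∀ s : ℂ, σ₀ ≤ s.re → s.re ≤ σ₁ → ‖bzI v w a s‖ ≤ M := by
  obtain ⟨C, hC0, hC⟩ := bzh_bound hv hw
  refine ⟨∫ t in Set.Ioi (0 : ℝ), C * (t ^ (σ₀ - 1) * Real.exp (-b * t)
    + t ^ (σ₁ - 1) * Real.exp (-b * t)), fun a ha s hs0 hs1 => ?_⟩
  unfold bzI mellin
  refine MeasureTheory.norm_integral_le_of_norm_le
    (((bz_int_rpow hb h0).add (bz_int_rpow hb h1)).const_mul C) ?_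
  refine (MeasureTheory.ae_restrict_iff' measurableSet_Ioi).2 (.of_forall fun t ht => ?_)
  have ht' : 0 < t := ht
  rw [norm_smul, Complex.norm_cpow_eq_rpow_re_of_pos ht', Complex.sub_re, Complex.one_re]
  have e1 : ‖bzf v w a t‖ ≤ C * Real.exp (-b * t) := by
    refine (bzf_norm hC a ht').trans ?_
    gcongr
  have e2 : t ^ (s.re - 1) ≤ t ^ (σ₀ - 1) + t ^ (σ₁ - 1) := by
    have q0 := Real.rpow_pos_of_pos ht' (σ₀ - 1)
    have q1 := Real.rpow_pos_of_pos ht' (σ₁ - 1)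
    rcases le_or_gt t 1 with h | h
    · have := Real.rpow_le_rpow_of_exponent_ge ht' h (sub_le_sub_right hs0 1)
      linarith
    · have := Real.rpow_le_rpow_of_exponent_le h.le (sub_le_sub_right hs1 1)
      linarith
  calc _ ≤ (t ^ (σ₀ - 1) + t ^ (σ₁ - 1)) * (C * Real.exp (-b * t)) := by gcongr
    _ = _ := by ring

noncomputable def bzF (v w a : ℝ) (s : ℂ) : ℂ :=
  (1 / (v * w) : ℂ) * ((a : ℂ) ^ (2 - s) / ((s - 1) * (s - 2)))
    + ((1 / v + 1 / w) / 2 : ℂ) * ((a : ℂ) ^ (1 - s) / (s - 1))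
    + bzI v w a s * (Complex.Gamma s)⁻¹

lemma bzF_diff {v w a : ℝ} (ha : 0 < a) (hv : 0 < v) (hw : 0 < w) {s : ℂ} (hs : 0 < s.re)
    (h1 : s ≠ 1) (h2 : s ≠ 2) : DifferentiableAt ℂ (bzF v w a) s := by
  unfold bzF
  have i1 := bzI_diff ha hv hw hs
  have i2 : DifferentiableAt ℂ (fun s => (Complex.Gamma s)⁻¹) s :=
    Complex.differentiable_one_div_Gamma s
  have e1 := sub_ne_zero.2 h1
  have e2 := sub_ne_zero.2 h2
  have ha' : (a : ℂ) ≠ 0 := by exact_mod_cast ha.ne'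
  have i3 : DifferentiableAt ℂ (fun s : ℂ => (a : ℂ) ^ (2 - s)) s :=
    ((differentiableAt_const _).sub differentiableAt_id).const_cpow (Or.inl ha')
  have i4 : DifferentiableAt ℂ (fun s : ℂ => (a : ℂ) ^ (1 - s)) s :=
    ((differentiableAt_const _).sub differentiableAt_id).const_cpow (Or.inl ha')
  have e3 : (s - 1) * (s - 2) ≠ 0 := mul_ne_zero e1 e2
  fun_prop (disch := assumption)

lemma bzF_mero {v w a : ℝ} (ha : 0 < a) (hv : 0 < v) (hw : 0 < w) :
    MeromorphicOn (bzF v w a) {s : ℂ | 0 < s.re} := by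
  intro s hs
  have hopen : IsOpen {s : ℂ | 0 < s.re} := isOpen_lt continuous_const Complex.continuous_re
  have ha' : (a : ℂ) ≠ 0 := by exact_mod_cast ha.ne'
  have han : ∀ {g : ℂ → ℂ}, (∀ z : ℂ, 0 < z.re → DifferentiableAt ℂ g z) → MeromorphicAt g s := by
    intro g hg
    have : DifferentiableOn ℂ g {s : ℂ | 0 < s.re} := fun z hz => (hg z hz).differentiableWithinAt
    exact (this.analyticAt (hopen.mem_nhds hs)).meromorphicAt
  have i1 : MeromorphicAt (bzI v w a) s := han fun z hz => bzI_diff ha hv hw hz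
  have i2 : MeromorphicAt (fun s => (Complex.Gamma s)⁻¹) s :=
    han fun z _ => Complex.differentiable_one_div_Gamma z
  have i3 : MeromorphicAt (fun s : ℂ => (a : ℂ) ^ (2 - s)) s := han fun z _ =>
    ((differentiableAt_const _).sub differentiableAt_id).const_cpow (Or.inl ha')
  have i4 : MeromorphicAt (fun s : ℂ => (a : ℂ) ^ (1 - s)) s := han fun z _ =>
    ((differentiableAt_const _).sub differentiableAt_id).const_cpow (Or.inl ha')
  have i5 : MeromorphicAt (fun s : ℂ => s - 1) s := han fun z _ => by fun_prop
  have i6 : MeromorphicAt (fun s : ℂ => s - 2) s := han fun z _ => by fun_prop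
  exact (((MeromorphicAt.const _ s).mul (i3.div (i5.mul i6))).add
    ((MeromorphicAt.const _ s).mul (i4.div i5))).add (i1.mul i2)

lemma bz_cpow_deriv {a : ℝ} (ha : 0 < a) (r : ℂ) :
    HasDerivAt (fun b : ℝ => (b : ℂ) ^ r) (r * (a : ℂ) ^ (r - 1)) a := by
  have h := (hasDerivAt_id (a : ℂ)).cpow_const (c := r) (Or.inl (by simpa using ha))
  have := h.comp_ofReal
  simpa using this

lemma bzF_deriv {v w a : ℝ} (ha : 0 < a) (hv : 0 < v) (hw : 0 < w) {s : ℂ} (hs : 0 < s.re)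
    (h1 : s ≠ 1) (h2 : s ≠ 2) :
    HasDerivAt (fun b : ℝ => bzF v w b s) (-s * bzF v w a (s + 1)) a := by
  have e1 := sub_ne_zero.2 h1
  have e2 := sub_ne_zero.2 h2
  have hs0 : s ≠ 0 := by rintro rfl; simp at hs
  have hG : Complex.Gamma s ≠ 0 := Complex.Gamma_ne_zero_of_re_pos hs
  have d := ((((bz_cpow_deriv ha (2 - s)).div_const ((s - 1) * (s - 2))).const_mul
    (1 / (v * w) : ℂ)).add (((bz_cpow_deriv ha (1 - s)).div_const (s - 1)).const_mul
    ((1 / v + 1 / w) / 2 : ℂ))).add ((bzI_deriv ha hv hw hs).mul_const (Complex.Gamma s)⁻¹)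
  unfold bzF
  convert! d using 1
  rw [Complex.Gamma_add_one s hs0]
  have q1 : 2 - s - 1 = 1 - s := by ring
  have q2 : 2 - (s + 1) = 1 - s := by ring
  have q3 : 1 - (s + 1) = -s := by ring
  have q4 : 1 - s - 1 = -s := by ring
  have q5 : s + 1 - 1 = s := by ring
  have q6 : s + 1 - 2 = s - 1 := by ring
  have q7 : 2 - s = -(s - 2) := by ring
  rw [q1, q2, q3, q4, q5, q6, q7]
  have q8 : (1 - s) * (a : ℂ) ^ (-s) = -((s - 1) * (a : ℂ) ^ (-s)) := by ring
  rw [q8]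
  field_simp
  ring

lemma bz_summable1 {a v τ : ℝ} (ha : 0 < a) (hv : 0 < v) (hτ : 1 < τ) :
    Summable fun m : ℕ => 1 / (a + m * v) ^ τ := by
  have h := ((Real.summable_one_div_nat_add_rpow (a / v) τ).2 hτ).mul_left (1 / v ^ τ)
  refine h.congr fun m => ?_
  have h1 : 0 < (m : ℝ) + a / v := by positivity
  have h2 : a + m * v = v * (m + a / v) := by field_simp; ring
  rw [abs_of_pos h1, h2, Real.mul_rpow hv.le h1.le]
  field_simp

lemma bz_summable {a v w σ : ℝ} (ha : 0 < a) (hv : 0 < v) (hw : 0 < w) (hσ : 2 < σ) :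
    Summable fun p : ℕ × ℕ => 1 / (a + (p.1 : ℝ) * v + (p.2 : ℝ) * w) ^ σ := by
  have h := (bz_summable1 ha hv (τ := σ / 2) (by linarith)).mul_of_nonneg
    (bz_summable1 ha hw (τ := σ / 2) (by linarith)) (fun m => by positivity) (fun m => by positivity)
  refine Summable.of_nonneg_of_le (fun p => by positivity) (fun p => ?_) h
  have h1 : (a + (p.1 : ℝ) * v + (p.2 : ℝ) * w) ^ σ
      = (a + (p.1 : ℝ) * v + (p.2 : ℝ) * w) ^ (σ / 2) * (a + (p.1 : ℝ) * v + (p.2 : ℝ) * w) ^ (σ / 2) := by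
    rw [← Real.rpow_add (by positivity)]; congr 1; ring
  rw [h1, ← one_div_mul_one_div]
  have n1 : 0 ≤ (p.1 : ℝ) * v := by positivity
  have n2 : 0 ≤ (p.2 : ℝ) * w := by positivity
  refine mul_le_mul (one_div_le_one_div_of_le (by positivity) ?_)
    (one_div_le_one_div_of_le (by positivity) ?_) (by positivity) (by positivity)
  · exact Real.rpow_le_rpow (by positivity) (by linarith) (by linarith)
  · exact Real.rpow_le_rpow (by positivity) (by linarith) (by linarith)

lemma bzE_mellin {a : ℝ} (ha : 0 < a) {s : ℂ} (hs : 0 < s.re) :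
    HasMellin (fun t : ℝ => ((Real.exp (-a * t) : ℝ) : ℂ)) s ((a : ℂ) ^ (-s) * Complex.Gamma s) := by
  constructor
  · refine mellinConvergent_of_isBigO_rpow_exp ha (b := 0)
      ((Continuous.continuousOn (by fun_prop)).locallyIntegrableOn measurableSet_Ioi) ?_ ?_ hs
    · refine Asymptotics.IsBigO.of_bound 1 (.of_forall fun t => ?_)
      rw [Complex.norm_real, one_mul]
    · refine Asymptotics.IsBigO.of_bound 1 ?_
      filter_upwards [self_mem_nhdsWithin] with t ht
      have ht' : 0 < t := ht
      rw [Complex.norm_real, Real.norm_of_nonneg (Real.exp_pos _).le]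
      simp only [neg_zero, Real.rpow_zero, norm_one, mul_one]
      rw [Real.exp_le_one_iff]
      nlinarith
  · have h := Complex.integral_cpow_mul_exp_neg_mul_Ioi hs ha
    have h2 : (1 / (a : ℂ)) ^ s = (a : ℂ) ^ (-s) := by
      rw [one_div, Complex.cpow_neg, Complex.inv_cpow]
      rw [Complex.arg_ofReal_of_nonneg ha.le]; exact Real.pi_pos.ne
    rw [h2] at h
    rw [← h, mellin]
    refine MeasureTheory.setIntegral_congr_fun measurableSet_Ioi fun t _ => ?_
    simp

lemma bzF_eq {v w a : ℝ} (ha : 0 < a) (hv : 0 < v) (hw : 0 < w) {s : ℂ} (hs : 2 < s.re) :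
    bzF v w a s = ∑' p : ℕ × ℕ, ((a + (p.1 : ℝ) * v + (p.2 : ℝ) * w : ℝ) : ℂ) ^ (-s) := by
  set Φ : ℝ → ℂ := fun t => ((Real.exp (-a * t) * ((1 - Real.exp (-(v * t)))⁻¹ *
    (1 - Real.exp (-(w * t)))⁻¹) : ℝ) : ℂ) with hΦ
  have hG : Complex.Gamma s ≠ 0 := Complex.Gamma_ne_zero_of_re_pos (by linarith)
  have hsum := hasSum_mellin (ι := ℕ × ℕ) (a := fun _ => 1)
    (p := fun p => a + (p.1 : ℝ) * v + (p.2 : ℝ) * w) (F := Φ) (s := s)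
    (fun i => Or.inr (by positivity)) (by linarith) ?_
    (by simpa only [norm_one] using bz_summable ha hv hw hs)
  · have h1 := (hsum.mul_left (Complex.Gamma s)⁻¹).tsum_eq
    have h2 : mellin Φ s = (1 / (v * w) : ℂ) * ((a : ℂ) ^ (-(s + -2)) * Complex.Gamma (s + -2))
        + ((1 / v + 1 / w) / 2 : ℂ) * ((a : ℂ) ^ (-(s + -1)) * Complex.Gamma (s + -1))
        + bzI v w a s := by
      have m2 := bzE_mellin ha (s := s + -2) (by simp; linarith)
      have m1 := bzE_mellin ha (s := s + -1) (by simp; linarith)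
      have c2 := (MellinConvergent.cpow_smul.2 m2.1).const_smul (1 / (v * w) : ℂ)
      have c1 := (MellinConvergent.cpow_smul.2 m1.1).const_smul ((1 / v + 1 / w) / 2 : ℂ)
      have c0 := bzI_conv ha hv hw (s := s) (by linarith)
      have a1 := hasMellin_add c2 c1
      have a2 := hasMellin_add a1.1 c0
      have e := a2.2
      rw [a1.2, mellin_const_smul, mellin_const_smul, mellin_cpow_smul, mellin_cpow_smul,
        m2.2, m1.2] at e
      simp only [smul_eq_mul] at e
      rw [bzI, ← e, mellin, mellin]
      refine MeasureTheory.setIntegral_congr_fun measurableSet_Ioi fun t ht => ?_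
      have ht' : 0 < t := ht
      simp only [smul_eq_mul]
      congr 1
      have z1 : (t : ℂ) ^ (-1 : ℂ) = ((t⁻¹ : ℝ) : ℂ) := by
        rw [Complex.cpow_neg_one]; push_cast; rfl
      have z2 : (t : ℂ) ^ (-2 : ℂ) = (((t ^ 2)⁻¹ : ℝ) : ℂ) := by
        rw [Complex.cpow_neg]; push_cast; congr 1; exact_mod_cast Complex.cpow_natCast (t : ℂ) 2
      have p1 := (bz_one_sub_pos (mul_pos hv ht')).ne'
      have p2 := (bz_one_sub_pos (mul_pos hw ht')).ne'
      have hreal : Real.exp (-a * t) * ((1 - Real.exp (-(v * t)))⁻¹ * (1 - Real.exp (-(w * t)))⁻¹)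
          = 1 / (v * w) * ((t ^ 2)⁻¹ * Real.exp (-a * t))
            + (1 / v + 1 / w) / 2 * (t⁻¹ * Real.exp (-a * t))
            + Real.exp (-a * t) * bzh v w t := by
        unfold bzh
        field_simp
        ring
      rw [z1, z2, hΦ, bzf]
      simp only [hreal]
      push_cast
      ring
    have g1 : Complex.Gamma s = (s - 1) * ((s - 2) * Complex.Gamma (s - 2)) := by
      have n1 : s - 1 ≠ 0 := fun h => by
        rw [sub_eq_zero] at h; rw [h] at hs; norm_num at hs
      have n2 : s - 2 ≠ 0 := fun h => by
        rw [sub_eq_zero] at h; rw [h] at hs; norm_num at hs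
      rw [← Complex.Gamma_add_one _ n2]
      have : s - 2 + 1 = s - 1 := by ring
      rw [this, ← Complex.Gamma_add_one _ n1, sub_add_cancel]
    have g2 : Complex.Gamma (s - 1) = (s - 2) * Complex.Gamma (s - 2) := by
      have n2 : s - 2 ≠ 0 := fun h => by
        rw [sub_eq_zero] at h; rw [h] at hs; norm_num at hs
      rw [← Complex.Gamma_add_one _ n2]
      congr 1; ring
    have h3 : bzF v w a s = (Complex.Gamma s)⁻¹ * mellin Φ s := by
      rw [h2]
      unfold bzF
      have r1 : s + -2 = s - 2 := by ring
      have r2 : s + -1 = s - 1 := by ring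
      rw [r1, r2, neg_sub, neg_sub, g2]
      rw [g1] at hG ⊢
      have k1 : s - 1 ≠ 0 := left_ne_zero_of_mul hG
      have k2 : s - 2 ≠ 0 := left_ne_zero_of_mul (right_ne_zero_of_mul hG)
      have k3 : Complex.Gamma (s - 2) ≠ 0 := right_ne_zero_of_mul (right_ne_zero_of_mul hG)
      field_simp
    rw [h3, ← h1]
    refine tsum_congr fun p => ?_
    rw [Complex.cpow_neg]
    field_simp
  · intro t ht
    have ht' : 0 < t := ht
    have q : ∀ x : ℝ, 0 < x → HasSum (fun m : ℕ => Real.exp (-(x * t)) ^ m) (1 - Real.exp (-(x * t)))⁻¹ :=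
      fun x hx => hasSum_geometric_of_lt_one (Real.exp_pos _).le
        (by rw [Real.exp_lt_one_iff]; have := mul_pos hx ht'; linarith)
    have q1 := (q v hv).mul (q w hw) ((q v hv).summable.mul_of_nonneg (q w hw).summable
      (fun m => by positivity) (fun m => by positivity))
    have q2 := q1.mul_left (Real.exp (-a * t))
    have q3 := Complex.hasSum_ofReal.2 q2
    convert! q3 using 1
    ext p
    rw [one_mul, ← Real.exp_nat_mul, ← Real.exp_nat_mul, ← Real.exp_add, ← Real.exp_add]
    congr 2
    ring

lemma bzF_not_simple {v w a : ℝ} (ha : 0 < a) (hv : 0 < v) (hw : 0 < w) {j : ℝ} (hj : 0 < j)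
    (hj2 : j ≤ 2) (d : ℂ) : ¬ ∀ᶠ s in 𝓝[≠] (j : ℂ), bzF v w a s = d / (s - j) := by
  intro h
  set S : ℝ → ℝ := fun σ => ∑' p : ℕ × ℕ, 1 / (a + (p.1 : ℝ) * v + (p.2 : ℝ) * w) ^ σ with hS
  have hconn : IsConnected {s : ℂ | 0 < s.re} :=
    ⟨⟨1, by simp⟩, (convex_halfSpace_re_gt 0).isPreconnected⟩
  have hm : MeromorphicOn (fun s : ℂ => d / (s - j)) {s : ℂ | 0 < s.re} := fun s _ =>
    (MeromorphicAt.const d s).div ((MeromorphicAt.id s).sub (MeromorphicAt.const _ s))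
  have hSeq : ∀ σ : ℝ, 2 < σ → S σ = ‖d‖ / (σ - j) := by
    intro σ hσ
    have h1 := bz_identity (bzF_mero ha hv hw) hm hconn (x := (j : ℂ)) (y := (σ : ℂ))
      (by simpa using hj) (by simp; linarith) h
    have hσ1 : (σ : ℂ) ≠ 1 := by norm_cast; linarith
    have hσ2 : (σ : ℂ) ≠ 2 := by norm_cast; linarith
    have hσj : (σ : ℂ) - j ≠ 0 := by norm_cast; intro h; linarith
    have c1 : ContinuousAt (bzF v w a) (σ : ℂ) :=
      (bzF_diff ha hv hw (by simp; linarith) hσ1 hσ2).continuousAt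
    have c2 : ContinuousAt (fun s : ℂ => d / (s - j)) (σ : ℂ) := by
      fun_prop (disch := assumption)
    have h2 := ((c1.eventuallyEq_nhds_iff_eventuallyEq_nhdsNE c2).1 h1).eq_of_nhds
    rw [bzF_eq ha hv hw (by simpa using hσ)] at h2
    have h3 : (∑' p : ℕ × ℕ, ((a + (p.1 : ℝ) * v + (p.2 : ℝ) * w : ℝ) : ℂ) ^ (-(σ : ℂ)))
        = ((S σ : ℝ) : ℂ) := by
      rw [hS, Complex.ofReal_tsum]
      refine tsum_congr fun p => ?_
      rw [Complex.cpow_neg, ← Complex.ofReal_cpow (by positivity)]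
      push_cast
      rw [one_div]
    rw [h3] at h2
    have h4 := congrArg norm h2
    have h5 : 0 ≤ S σ := tsum_nonneg fun p => by positivity
    rw [Complex.norm_real, Real.norm_of_nonneg h5, norm_div, ← Complex.ofReal_sub,
      Complex.norm_real, Real.norm_of_nonneg (by linarith)] at h4
    exact h4
  have hlow : ∀ σ : ℝ, 2 < σ → 1 / a ^ σ ≤ S σ := by
    intro σ hσ
    have := (bz_summable ha hv hw hσ).le_tsum (0, 0) (fun p _ => by positivity)
    simpa [hS] using this
  have hup : ∀ σ : ℝ, 2 < σ → S (σ + 1) ≤ S σ * (1 / a) := by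
    intro σ hσ
    rw [hS]
    simp only
    rw [← tsum_mul_right]
    refine (bz_summable ha hv hw (by linarith)).tsum_le_tsum (fun p => ?_)
      ((bz_summable ha hv hw hσ).mul_right _)
    rw [Real.rpow_add (by positivity), Real.rpow_one, ← one_div_mul_one_div]
    have n1 : 0 ≤ (p.1 : ℝ) * v := by positivity
    have n2 : 0 ≤ (p.2 : ℝ) * w := by positivity
    refine mul_le_mul_of_nonneg_left (one_div_le_one_div_of_le ha (by linarith)) (by positivity)
  have hd : 0 < ‖d‖ := by
    have h1 := hlow 3 (by norm_num)
    rw [hSeq 3 (by norm_num)] at h1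
    have h2 : 0 < 1 / a ^ (3 : ℝ) := by positivity
    have h3 : 0 < 3 - j := by linarith
    by_contra hcon
    have : ‖d‖ / (3 - j) ≤ 0 := div_nonpos_of_nonpos_of_nonneg (not_lt.1 hcon) h3.le
    linarith
  rcases le_or_gt a 1 with h1 | h1
  · set σ := ‖d‖ + 2 + j with hσ
    have hσ2 : 2 < σ := by linarith
    have h2 := hlow σ hσ2
    rw [hSeq σ hσ2, le_div_iff₀ (by linarith)] at h2
    have h3 : 1 ≤ 1 / a ^ σ := by
      rw [le_div_iff₀ (by positivity), one_mul]
      exact Real.rpow_le_one ha.le h1 (by linarith)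
    nlinarith
  · have ha1 : 0 < a - 1 := by linarith
    have h5 : 0 < 1 / (a - 1) := by positivity
    set σ := j + 2 + 1 / (a - 1) with hσ
    have hσ2 : 2 < σ := by linarith
    have h2 := hup σ hσ2
    rw [hSeq σ hσ2, hSeq (σ + 1) (by linarith), div_mul_div_comm, mul_one,
      div_le_div_iff_of_pos_left hd (by linarith) (mul_pos (by linarith) ha)] at h2
    have h4 : (a - 1) * (1 / (a - 1)) = 1 := by field_simp
    have h6 : σ - j = 2 + 1 / (a - 1) := by rw [hσ]; ring
    nlinarith

lemma bz_circle {θ : ℝ} {z : ℂ} (hz : z = circleMap 1 (1 / 4) θ) :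
    z ∈ Metric.sphere (1 : ℂ) (1 / 4) := by
  rw [hz]; exact circleMap_mem_sphere 1 (by norm_num) θ

lemma bz_sphere {z : ℂ} (hz : z ∈ Metric.sphere (1 : ℂ) (1 / 4)) :
    3 / 4 ≤ z.re ∧ z.re ≤ 5 / 4 ∧ z ≠ 1 ∧ z ≠ 2 := by
  rw [mem_sphere_iff_norm] at hz
  have h1 := Complex.abs_re_le_norm (z - 1)
  rw [hz, abs_le, Complex.sub_re, Complex.one_re] at h1
  refine ⟨by linarith, by linarith, ?_, ?_⟩
  · rintro rfl; norm_num at hz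
  · rintro rfl; norm_num at hz

lemma bzF_bdd {v w α : ℝ} (hα : 0 < α) (hv : 0 < v) (hw : 0 < w) :
    ∃ M : ℝ, ∀ a ∈ Set.Icc (α / 2) (2 * α), ∀ s ∈ Metric.sphere (1 : ℂ) (1 / 4),
      ‖bzF v w a (s + 1)‖ ≤ M := by
  obtain ⟨M, hM⟩ := bzI_bdd (b := α / 2) (σ₀ := 1) (σ₁ := 3) (by linarith) hv hw one_pos (by norm_num)
  have hK : IsCompact (Set.Icc (α / 2) (2 * α) ×ˢ Metric.sphere (1 : ℂ) (1 / 4)) :=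
    isCompact_Icc.prod (isCompact_sphere _ _)
  obtain ⟨M1, hM1⟩ := hK.exists_bound_of_continuousOn (f := fun p : ℝ × ℂ =>
    (1 / (v * w) : ℂ) * ((p.1 : ℂ) ^ (2 - (p.2 + 1)) / (((p.2 + 1) - 1) * ((p.2 + 1) - 2)))
    + ((1 / v + 1 / w) / 2 : ℂ) * ((p.1 : ℂ) ^ (1 - (p.2 + 1)) / ((p.2 + 1) - 1))) (by
      rintro ⟨a, s⟩ ⟨ha, hs⟩
      obtain ⟨b1, b2, b3, b4⟩ := bz_sphere hs
      have ha0 : 0 < a := by have := ha.1; linarith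
      apply ContinuousAt.continuousWithinAt
      have hsl : ((a : ℂ)) ∈ Complex.slitPlane := Or.inl (by simpa using ha0)
      have k1 : ContinuousAt (fun p : ℝ × ℂ => (p.1 : ℂ) ^ (2 - (p.2 + 1))) (a, s) :=
        ContinuousAt.cpow (by fun_prop) (by fun_prop) hsl
      have k2 : ContinuousAt (fun p : ℝ × ℂ => (p.1 : ℂ) ^ (1 - (p.2 + 1))) (a, s) :=
        ContinuousAt.cpow (by fun_prop) (by fun_prop) hsl
      have e1 : s + 1 - 1 ≠ 0 := by
        rw [add_sub_cancel_right]; rintro rfl; norm_num at b1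
      have e2 : s + 1 - 2 ≠ 0 := by
        intro h; apply b3; linear_combination h
      have e3 : (s + 1 - 1) * (s + 1 - 2) ≠ 0 := mul_ne_zero e1 e2
      fun_prop (disch := assumption))
  obtain ⟨M2, hM2⟩ := (isCompact_sphere (1 : ℂ) (1 / 4)).exists_bound_of_continuousOn
    (f := fun s : ℂ => (Complex.Gamma (s + 1))⁻¹)
    ((Complex.differentiable_one_div_Gamma.continuous.comp (continuous_add_const 1)).continuousOn)
  refine ⟨M1 + M * M2, fun a ha s hs => ?_⟩
  obtain ⟨b1, b2, b3, b4⟩ := bz_sphere hs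
  unfold bzF
  have x1 := hM1 (a, s) ⟨ha, hs⟩
  have x2 := hM2 s hs
  have x3 := hM a ha.1 (s + 1) (by simp; linarith) (by simp; linarith)
  refine (norm_add_le _ _).trans (add_le_add x1 ?_)
  rw [norm_mul]
  exact mul_le_mul x3 x2 (norm_nonneg _) ((norm_nonneg _).trans x3)

lemma bz_cont_circle {f : ℂ → ℂ} (hf : ∀ z ∈ Metric.sphere (1 : ℂ) (1 / 4), ContinuousAt f z) (n : ℕ) :
    Continuous fun θ : ℝ => deriv (circleMap 1 (1 / 4)) θ •
      (f (circleMap 1 (1 / 4) θ) * ((circleMap 1 (1 / 4) θ - 1) ^ n)⁻¹) := by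
  rw [continuous_iff_continuousAt]
  intro θ
  have hz := bz_circle (θ := θ) rfl
  obtain ⟨b1, b2, b3, b4⟩ := bz_sphere hz
  have k1 : ContinuousAt (fun θ : ℝ => f (circleMap 1 (1 / 4) θ)) θ :=
    ContinuousAt.comp (f := circleMap 1 (1 / 4)) (hf _ hz) (continuous_circleMap 1 (1 / 4)).continuousAt
  have k2 : ContinuousAt (fun θ : ℝ => circleMap 1 (1 / 4) θ - 1) θ := by fun_prop
  have k3 := (k2.pow n).inv₀ (pow_ne_zero n (sub_ne_zero.2 b3))
  have k4 : ContinuousAt (fun θ : ℝ => deriv (circleMap 1 (1 / 4)) θ) θ := by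
    simp only [deriv_circleMap]; fun_prop
  exact k4.smul (k1.mul k3)

lemma bz_coef_deriv {v w α : ℝ} (hα : 0 < α) (hv : 0 < v) (hw : 0 < w) (n : ℕ) :
    HasDerivAt (fun a : ℝ => ∮ s in C(1, 1 / 4), bzF v w a s * ((s - 1) ^ n)⁻¹)
      (∮ s in C(1, 1 / 4), (-s * bzF v w α (s + 1)) * ((s - 1) ^ n)⁻¹) α := by
  obtain ⟨M, hM⟩ := bzF_bdd hα hv hw
  have hcF : ∀ a : ℝ, 0 < a → ∀ z ∈ Metric.sphere (1 : ℂ) (1 / 4), ContinuousAt (bzF v w a) z := by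
    intro a ha z hz
    obtain ⟨b1, b2, b3, b4⟩ := bz_sphere hz
    exact (bzF_diff ha hv hw (by linarith) b3 b4).continuousAt
  have hcF' : ∀ z ∈ Metric.sphere (1 : ℂ) (1 / 4),
      ContinuousAt (fun s => -s * bzF v w α (s + 1)) z := by
    intro z hz
    obtain ⟨b1, b2, b3, b4⟩ := bz_sphere hz
    have h1 : ContinuousAt (bzF v w α) (z + 1) := (bzF_diff hα hv hw (by simp; linarith)
      (fun h => by
        have : z = 0 := by linear_combination h
        rw [this] at b1; norm_num at b1)
      (fun h => b3 (by linear_combination h))).continuousAt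
    have h2 : ContinuousAt (fun s => bzF v w α (s + 1)) z :=
      ContinuousAt.comp (f := fun s : ℂ => s + 1) h1 (by fun_prop)
    exact continuousAt_id.neg.mul h2
  unfold circleIntegral
  refine (intervalIntegral.hasDerivAt_integral_of_dominated_loc_of_deriv_le
    (μ := MeasureTheory.volume)
    (F := fun (a : ℝ) (θ : ℝ) => deriv (circleMap 1 (1 / 4)) θ •
      (bzF v w a (circleMap 1 (1 / 4) θ) * ((circleMap 1 (1 / 4) θ - 1) ^ n)⁻¹))
    (F' := fun (a : ℝ) (θ : ℝ) => deriv (circleMap 1 (1 / 4)) θ •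
      ((-circleMap 1 (1 / 4) θ * bzF v w a (circleMap 1 (1 / 4) θ + 1)) *
        ((circleMap 1 (1 / 4) θ - 1) ^ n)⁻¹))
    (s := Set.Icc (α / 2) (2 * α)) (bound := fun _ => 1 / 4 * ((2 * M) * ((1 / 4) ^ n)⁻¹))
    (Icc_mem_nhds (by linarith) (by linarith)) ?_ ?_ ?_ ?_ ?_ ?_).2
  · filter_upwards [Ioi_mem_nhds hα] with a ha
    exact (bz_cont_circle (hcF a ha) n).aestronglyMeasurable
  · exact (bz_cont_circle (hcF α hα) n).intervalIntegrable _ _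
  · exact (bz_cont_circle hcF' n).aestronglyMeasurable
  · refine .of_forall fun θ _ a ha => ?_
    have hz := bz_circle (θ := θ) rfl
    have hn := mem_sphere_iff_norm.1 hz
    have hM' := hM a ha _ hz
    have h2 : ‖circleMap 1 (1 / 4) θ‖ ≤ 2 := by
      have := norm_add_le (circleMap 1 (1 / 4) θ - 1) 1
      rw [sub_add_cancel, hn, norm_one] at this
      linarith
    rw [norm_smul, deriv_circleMap, norm_mul, norm_mul, norm_inv, norm_pow, hn, norm_mul, norm_neg]
    simp only [norm_circleMap_zero, Complex.norm_I, mul_one]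
    rw [abs_of_pos (by norm_num : (0 : ℝ) < 1 / 4)]
    gcongr
  · exact intervalIntegrable_const
  · refine .of_forall fun θ _ a ha => ?_
    have hz := bz_circle (θ := θ) rfl
    obtain ⟨b1, b2, b3, b4⟩ := bz_sphere hz
    have ha0 : 0 < a := by have := ha.1; linarith
    exact ((bzF_deriv ha0 hv hw (by linarith) b3 b4).mul_const
      ((circleMap 1 (1 / 4) θ - 1) ^ n)⁻¹).const_smul (deriv (circleMap 1 (1 / 4)) θ)

lemma bz_telescope (g : ℤ → ℂ) (D : ℤ → ℂ) (h0 : D (-1) = -g (-1))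
    (hD : ∀ n : ℕ, D n = -(g n + g (n - 1))) (k : ℕ) :
    (∑ l ∈ Finset.Icc (-1 : ℤ) (k : ℤ), (-1 : ℂ) ^ ((k : ℤ) - l + 1).toNat * D l) = g k := by
  have hins : ∀ m : ℤ, -1 ≤ m → Finset.Icc (-1 : ℤ) (m + 1) = insert (m + 1) (Finset.Icc (-1 : ℤ) m) := by
    intro m hm; ext x; simp only [Finset.mem_Icc, Finset.mem_insert]; omega
  have hstep : ∀ m : ℤ, -1 ≤ m →
      (∑ l ∈ Finset.Icc (-1 : ℤ) (m + 1), (-1 : ℂ) ^ ((m + 1) - l + 1).toNat * D l)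
      = -D (m + 1) - ∑ l ∈ Finset.Icc (-1 : ℤ) m, (-1 : ℂ) ^ (m - l + 1).toNat * D l := by
    intro m hm
    rw [hins m hm, Finset.sum_insert (by simp), sub_eq_add_neg (-D (m + 1)), ← Finset.sum_neg_distrib]
    congr 1
    · simp
    · refine Finset.sum_congr rfl fun l hl => ?_
      rw [Finset.mem_Icc] at hl
      have : (m + 1 - l + 1).toNat = (m - l + 1).toNat + 1 := by omega
      rw [this, pow_succ]; ring
  have hbase : (∑ l ∈ Finset.Icc (-1 : ℤ) (-1), (-1 : ℂ) ^ ((-1 : ℤ) - l + 1).toNat * D l) = g (-1) := by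
    simp [h0]
  induction k with
  | zero =>
    have := hstep (-1) le_rfl
    rw [hbase] at this
    have h1 := hD 0
    norm_num at this h1 ⊢
    rw [this, h1]; ring
  | succ k ih =>
    have := hstep k (by omega)
    rw [ih] at this
    have h1 := hD (k + 1)
    push_cast at h1 ⊢
    rw [this, h1]
    rw [add_sub_cancel_right]; ring

theorem barnes_laurent_coeffs_relation
    (α v w : ℝ) (hα : 0 < α) (hv : 0 < v) (hw : 0 < w)
    (Z : ℝ → ℂ → ℂ)
    (hmero : ∀ a : ℝ, 0 < a → MeromorphicOn (Z a) Set.univ)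
    (hZ : ∀ a : ℝ, 0 < a → ∀ s : ℂ, 2 < s.re →
      Z a s = ∑' p : ℕ × ℕ, ((a + (p.1 : ℝ) * v + (p.2 : ℝ) * w : ℝ) : ℂ) ^ (-s))
    (hfe : ∀ a : ℝ, 0 < a → ∀ s : ℂ,
      HasDerivAt (fun t : ℝ => Z t s) (-s * Z a (s + 1)) a)
    (γ₁ γ₂ : ℝ → ℤ → ℂ)
    (hγ₁ : ∀ a : ℝ, 0 < a → ∃ r : ℝ, 0 < r ∧
      ∀ s : ℂ, s ∈ Metric.ball (1 : ℂ) r → s ≠ 1 →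
        Z a s = γ₁ a (-1) / (s - 1) + ∑' k : ℕ, γ₁ a (k : ℤ) * (s - 1) ^ k)
    (hγ₂ : ∀ a : ℝ, 0 < a → ∃ r : ℝ, 0 < r ∧
      ∀ s : ℂ, s ∈ Metric.ball (2 : ℂ) r → s ≠ 2 →
        Z a s = γ₂ a (-1) / (s - 2) + ∑' k : ℕ, γ₂ a (k : ℤ) * (s - 2) ^ k) :
    ∀ k : ℕ,
      (∑ l ∈ Finset.Icc (-1 : ℤ) (k : ℤ),
          (-1 : ℂ) ^ ((k : ℤ) - l + 1).toNat *
            deriv (fun a : ℝ => γ₁ a l) α)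
        = γ₂ α (k : ℤ) := by
  have hconn : IsConnected {s : ℂ | 0 < s.re} :=
    ⟨⟨1, by simp⟩, (convex_halfSpace_re_gt 0).isPreconnected⟩
  -- `Z a` agrees with the explicit continuation near every point of the half plane
  have hZF : ∀ a : ℝ, 0 < a → ∀ y : ℂ, 0 < y.re → ∀ᶠ s in 𝓝[≠] y, Z a s = bzF v w a s := by
    intro a ha y hy
    refine bz_identity ((hmero a ha).mono_set (Set.subset_univ _)) (bzF_mero ha hv hw) hconn
      (x := 3) (by simp) hy ?_
    have hopen : IsOpen {s : ℂ | 2 < s.re} := isOpen_lt continuous_const Complex.continuous_re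
    filter_upwards [mem_nhdsWithin_of_mem_nhds (hopen.mem_nhds (show (3 : ℂ) ∈ {s : ℂ | 2 < s.re} by
      norm_num))] with s hs
    rw [hZ a ha s hs, bzF_eq ha hv hw hs]
  have hL1 : ∀ a : ℝ, 0 < a → ∀ n : ℕ,
      (∮ s in C(1, 1 / 4), bzF v w a s * ((s - 1) ^ n)⁻¹)
        = 2 * Real.pi * Complex.I * γ₁ a (n - 1) := by
    intro a ha
    refine (bz_laurent (R' := 1 / 2) (by norm_num) (by norm_num) ?_ (γ₁ a) ?_ ?_).1
    · intro s hs hs1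
      rw [Metric.mem_ball, dist_eq_norm] at hs
      have h1 := (Complex.abs_re_le_norm (s - 1)).trans_lt hs
      rw [abs_lt, Complex.sub_re, Complex.one_re] at h1
      refine bzF_diff ha hv hw (by linarith) hs1 ?_
      rintro rfl; norm_num at hs
    · obtain ⟨r, hr, h⟩ := hγ₁ a ha
      filter_upwards [hZF a ha 1 (by simp), self_mem_nhdsWithin,
        mem_nhdsWithin_of_mem_nhds (Metric.ball_mem_nhds (1 : ℂ) hr)] with s h1 h2 h3
      rw [← h1, h s h3 h2]
    · intro d
      simpa using bzF_not_simple ha hv hw (j := 1) one_pos (by norm_num) d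
  have hsh : Tendsto (fun s : ℂ => s + 1) (𝓝[≠] 1) (𝓝[≠] 2) := by
    refine tendsto_nhdsWithin_of_tendsto_nhds_of_eventually_within _ ?_ ?_
    · have : Tendsto (fun s : ℂ => s + 1) (𝓝 1) (𝓝 (1 + 1)) := (continuous_add_const 1).tendsto 1
      rw [one_add_one_eq_two] at this
      exact this.mono_left nhdsWithin_le_nhds
    · filter_upwards [self_mem_nhdsWithin] with s hs h
      exact hs (by have h' : s + 1 = 2 := h
                   show s = 1
                   linear_combination h')
  have hsh' : Tendsto (fun s : ℂ => s - 1) (𝓝[≠] 2) (𝓝[≠] 1) := by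
    refine tendsto_nhdsWithin_of_tendsto_nhds_of_eventually_within _ ?_ ?_
    · have : Tendsto (fun s : ℂ => s - 1) (𝓝 2) (𝓝 (2 - 1)) := (continuous_sub_right 1).tendsto 2
      have e : (2 : ℂ) - 1 = 1 := by norm_num
      rw [e] at this
      exact this.mono_left nhdsWithin_le_nhds
    · filter_upwards [self_mem_nhdsWithin] with s hs h
      exact hs (by have h' : s - 1 = 1 := h
                   show s = 2
                   linear_combination h')
  have hd2 : ∀ s ∈ Metric.ball (1 : ℂ) (1 / 2), s ≠ 1 →
      DifferentiableAt ℂ (fun s => bzF v w α (s + 1)) s := by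
    intro s hs hs1
    rw [Metric.mem_ball, dist_eq_norm] at hs
    have h1 := (Complex.abs_re_le_norm (s - 1)).trans_lt hs
    rw [abs_lt, Complex.sub_re, Complex.one_re] at h1
    have h2 : DifferentiableAt ℂ (bzF v w α) (s + 1) := by
      refine bzF_diff hα hv hw (by simp; linarith) (fun h => ?_) (fun h => hs1 (by linear_combination h))
      have : s = 0 := by linear_combination h
      rw [this] at h1; norm_num at h1
    exact DifferentiableAt.comp (f := fun s : ℂ => s + 1) s h2 (by fun_prop)
  obtain ⟨hL2, hL2'⟩ := bz_laurent (f := fun s => bzF v w α (s + 1)) (c := 1) (R := 1 / 4)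
    (R' := 1 / 2) (by norm_num) (by norm_num) hd2 (γ₂ α) (by
      obtain ⟨r, hr, h⟩ := hγ₂ α hα
      have h0 : ∀ᶠ s in 𝓝[≠] (2 : ℂ), bzF v w α s
          = γ₂ α (-1) / (s - 2) + ∑' k : ℕ, γ₂ α (k : ℤ) * (s - 2) ^ k := by
        filter_upwards [hZF α hα 2 (by simp), self_mem_nhdsWithin,
          mem_nhdsWithin_of_mem_nhds (Metric.ball_mem_nhds (2 : ℂ) hr)] with s h1 h2 h3
        rw [← h1, h s h3 h2]
      filter_upwards [hsh.eventually h0] with s hs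
      have e : s + 1 - 2 = s - 1 := by ring
      rw [hs, e]) (by
      intro d hcon
      refine bzF_not_simple hα hv hw (j := 2) two_pos le_rfl d ?_
      have e2 : ((2 : ℝ) : ℂ) = 2 := by norm_num
      rw [e2]
      filter_upwards [hsh'.eventually hcon] with s hs
      have e : s - 1 - 1 = s - 2 := by ring
      rw [sub_add_cancel, e] at hs
      exact hs)
  have hpi : (2 * Real.pi * Complex.I : ℂ) ≠ 0 := Complex.two_pi_I_ne_zero
  -- the derivatives of the coefficients at `s = 1`
  have hder : ∀ n : ℕ, 2 * Real.pi * Complex.I * deriv (fun a : ℝ => γ₁ a ((n : ℤ) - 1)) α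
      = ∮ s in C(1, 1 / 4), (-s * bzF v w α (s + 1)) * ((s - 1) ^ n)⁻¹ := by
    intro n
    have h1 := (bz_coef_deriv hα hv hw n).const_mul (2 * Real.pi * Complex.I : ℂ)⁻¹
    have h2 := h1.congr_of_eventuallyEq (f₁ := fun a : ℝ => γ₁ a ((n : ℤ) - 1)) (by
      filter_upwards [Ioi_mem_nhds hα] with a ha
      rw [hL1 a ha n, ← mul_assoc, inv_mul_cancel₀ hpi, one_mul])
    rw [h2.deriv, ← mul_assoc, mul_inv_cancel₀ hpi, one_mul]
  have hci : ∀ n : ℕ, CircleIntegrable (fun s => bzF v w α (s + 1) * ((s - 1) ^ n)⁻¹) 1 (1 / 4) := by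
    intro n
    refine ContinuousOn.circleIntegrable (by norm_num) fun s hs => ?_
    obtain ⟨b1, b2, b3, b4⟩ := bz_sphere hs
    have h1 := (hd2 s (Metric.closedBall_subset_ball (by norm_num)
      (Metric.sphere_subset_closedBall hs)) b3).continuousAt
    have h2 : (s - 1) ^ n ≠ 0 := pow_ne_zero n (sub_ne_zero.2 b3)
    have h3 : ContinuousAt (fun s : ℂ => ((s - 1) ^ n)⁻¹) s := by fun_prop (disch := assumption)
    exact (h1.mul h3).continuousWithinAt
  have hci' : CircleIntegrable (fun s => bzF v w α (s + 1) * (s - 1)) 1 (1 / 4) := by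
    refine ContinuousOn.circleIntegrable (by norm_num) fun s hs => ?_
    obtain ⟨b1, b2, b3, b4⟩ := bz_sphere hs
    have h1 := (hd2 s (Metric.closedBall_subset_ball (by norm_num)
      (Metric.sphere_subset_closedBall hs)) b3).continuousAt
    have h3 : ContinuousAt (fun s : ℂ => s - 1) s := by fun_prop
    exact (h1.mul h3).continuousWithinAt
  refine bz_telescope (γ₂ α) (fun l => deriv (fun a : ℝ => γ₁ a l) α) ?_ ?_
  · have h := hder 0
    have e : (∮ s in C(1, 1 / 4), (-s * bzF v w α (s + 1)) * ((s - 1) ^ 0)⁻¹)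
        = (-1) * ((∮ s in C(1, 1 / 4), bzF v w α (s + 1) * (s - 1))
          + ∮ s in C(1, 1 / 4), bzF v w α (s + 1) * ((s - 1) ^ 0)⁻¹) := by
      rw [← circleIntegral.integral_add hci' (hci 0), ← circleIntegral.integral_const_mul]
      refine circleIntegral.integral_congr (by norm_num) fun s hs => ?_
      simp only [pow_zero, inv_one]
      ring
    rw [e, hL2', hL2 0] at h
    apply mul_left_cancel₀ hpi
    simp only [Nat.cast_zero, zero_sub, neg_zero] at h
    rw [h]; ring
  · intro n
    have h := hder (n + 1)
    have e : (∮ s in C(1, 1 / 4), (-s * bzF v w α (s + 1)) * ((s - 1) ^ (n + 1))⁻¹)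
        = (-1) * ((∮ s in C(1, 1 / 4), bzF v w α (s + 1) * ((s - 1) ^ n)⁻¹)
          + ∮ s in C(1, 1 / 4), bzF v w α (s + 1) * ((s - 1) ^ (n + 1))⁻¹) := by
      rw [← circleIntegral.integral_add (hci n) (hci (n + 1)), ← circleIntegral.integral_const_mul]
      refine circleIntegral.integral_congr (by norm_num) fun s hs => ?_
      have h5 := sub_ne_zero.2 (bz_sphere hs).2.2.1
      field_simp
      ring
    rw [e, hL2 n, hL2 (n + 1)] at h
    apply mul_left_cancel₀ hpi
    push_cast at h
    rw [add_sub_cancel_right] at h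
    rw [h]; ring
end

section
/- For α, v, w > 0, the constant term in the Laurent expansion of ζ₂(s,α;v,w) at s = 2 admits the integral representation γ₀(2,α;v,w) = −1/α² − (1+log α)/(vw) + (1/v²)ζ_H(2, α/v) + (1/w²)ζ_H(2, α/w) − (w/v)∫₀^∞ (x−⌊x⌋)/(α+wx)² dx − (v/w)∫₀^∞ (y−⌊y⌋)/(α+vy)² dy + 6vw∫₀^∞∫₀^∞ (x−⌊x⌋)(y−⌊y⌋)/(α+vy+wx)⁴ dx dy. -/
open Filter Topology MeasureTheory

namespace BarnesAux

/-- one-dimensional sawtooth integral -/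
noncomputable def sawI (A w p : ℝ) : ℝ :=
  ∫ x in Set.Ioi (0 : ℝ), (x - (⌊x⌋ : ℝ)) * (A + w * x) ^ (-p)

lemma hasDerivAt_aux {A w : ℝ} (q x : ℝ) (h : 0 < A + w * x) :
    HasDerivAt (fun x : ℝ => (A + w * x) ^ q) (q * w * (A + w * x) ^ (q - 1)) x := by
  have h1 : HasDerivAt (fun x : ℝ => A + w * x) w x := by
    simpa using ((hasDerivAt_id x).const_mul w).const_add A
  have := h1.rpow_const (p := q) (Or.inl h.ne')
  convert! this using 1
  ring

lemma pos_aux {A w x : ℝ} (hA : 0 < A) (hw : 0 < w) (hx : 0 ≤ x) : 0 < A + w * x := by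
  positivity

lemma tendsto_aux {A w q : ℝ} (hw : 0 < w) (hq : 0 < q) :
    Tendsto (fun x : ℝ => (A + w * x) ^ (-q)) atTop (𝓝 0) :=
  (tendsto_rpow_neg_atTop hq).comp
    (tendsto_atTop_add_const_left _ _ (tendsto_id.const_mul_atTop hw))

lemma pow_int {A w p : ℝ} (hA : 0 < A) (hw : 0 < w) (hp : 1 < p) :
    IntegrableOn (fun x : ℝ => (A + w * x) ^ (-p)) (Set.Ioi 0) ∧
    ∫ x in Set.Ioi (0 : ℝ), (A + w * x) ^ (-p) = A ^ (1 - p) / (w * (p - 1)) := by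
  have hp' : p - 1 ≠ 0 := by linarith
  have hd : ∀ x ∈ Set.Ici (0 : ℝ), HasDerivAt
      (fun x : ℝ => (-1 / (w * (p - 1))) * (A + w * x) ^ (-(p - 1))) ((A + w * x) ^ (-p)) x := by
    intro x hx
    have := (hasDerivAt_aux (-(p - 1)) x (pos_aux hA hw hx)).const_mul (-1 / (w * (p - 1)))
    convert! this using 1
    rw [show -(p - 1) - 1 = -p by ring]
    field_simp
  have hn : ∀ x ∈ Set.Ioi (0 : ℝ), 0 ≤ (A + w * x) ^ (-p) := fun x hx =>
    (Real.rpow_pos_of_pos (pos_aux hA hw (le_of_lt hx)) _).le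
  have ht : Tendsto (fun x : ℝ => (-1 / (w * (p - 1))) * (A + w * x) ^ (-(p - 1))) atTop
      (𝓝 0) := by
    simpa using (tendsto_aux (A := A) hw (show 0 < p - 1 by linarith)).const_mul
      (-1 / (w * (p - 1)))
  refine ⟨integrableOn_Ioi_deriv_of_nonneg' hd hn ht, ?_⟩
  rw [integral_Ioi_of_hasDerivAt_of_nonneg' hd hn ht]
  simp only [mul_zero, add_zero]
  rw [show -(p - 1) = 1 - p by ring]
  ring

lemma saw_nonneg (x : ℝ) : 0 ≤ x - (⌊x⌋ : ℝ) := sub_nonneg.2 (Int.floor_le x)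
lemma saw_le (x : ℝ) : x - (⌊x⌋ : ℝ) ≤ 1 := by linarith [Int.lt_floor_add_one x]

lemma saw_bound {x a b : ℝ} (h : |a| ≤ b) : ‖(x - (⌊x⌋ : ℝ)) * a‖ ≤ b := by
  rw [Real.norm_eq_abs, abs_mul, abs_of_nonneg (saw_nonneg x)]
  nlinarith [saw_nonneg x, saw_le x, abs_nonneg a]

lemma saw_meas : Measurable (fun x : ℝ => x - (⌊x⌋ : ℝ)) := by fun_prop

lemma saw_int {g : ℝ → ℝ} (hg : IntegrableOn g (Set.Ioi 0)) :
    IntegrableOn (fun x : ℝ => (x - (⌊x⌋ : ℝ)) * g x) (Set.Ioi 0) := by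
  refine Integrable.mono' hg.norm (saw_meas.aestronglyMeasurable.mul hg.aestronglyMeasurable) ?_
  exact Eventually.of_forall fun x => saw_bound le_rfl

lemma tail_sum {A w p : ℝ} (hA : 0 < A) (hw : 0 < w) (hp : 1 < p) :
    HasSum (fun m : ℕ => (A + w * ((m : ℝ) + 1)) ^ (-p))
      (A ^ (1 - p) / (w * (p - 1)) - p * w * sawI A w (p + 1)) := by
  obtain ⟨i1, e1⟩ := pow_int hA hw hp
  obtain ⟨i2, -⟩ := pow_int hA hw (show 1 < p + 1 by linarith)
  have i3 := saw_int i2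
  have i4 := i1.sub (i3.const_mul (p * w))
  have hmono : Monotone (fun n : ℕ => (n : ℝ)) := Nat.mono_cast
  have hU : ⋃ n : ℕ, Set.Ioc (n : ℝ) ((n + 1 : ℕ) : ℝ) = Set.Ioi 0 := by
    have := iUnion_Ioc_map_succ_eq_Ioi (f := fun n : ℕ => (n : ℝ)) (fun a => by simp) (by
      rintro ⟨b, hb⟩
      obtain ⟨n, hn⟩ := exists_nat_gt b
      exact absurd (hb ⟨n, rfl⟩) (not_le.2 hn))
    simpa using this
  have hs := hasSum_integral_iUnion (μ := volume)
    (f := fun x : ℝ => (A + w * x) ^ (-p) - p * w * ((x - (⌊x⌋ : ℝ)) * (A + w * x) ^ (-(p + 1))))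
    (s := fun n : ℕ => Set.Ioc (n : ℝ) ((n + 1 : ℕ) : ℝ)) (fun _ => measurableSet_Ioc)
    hmono.pairwise_disjoint_on_Ioc_succ (by rw [hU]; exact i4)
  rw [hU, integral_sub i1 (i3.const_mul _), e1, integral_const_mul] at hs
  convert! hs using 1
  funext n
  rw [integral_Ioc_eq_integral_Ioo]
  have hc : ∀ x ∈ Set.Ioo (n : ℝ) ((n + 1 : ℕ) : ℝ),
      (A + w * x) ^ (-p) - p * w * ((x - (⌊x⌋ : ℝ)) * (A + w * x) ^ (-(p + 1))) =
      (A + w * x) ^ (-p) - p * w * ((x - n) * (A + w * x) ^ (-(p + 1))) := by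
    intro x hx
    have : ⌊x⌋ = (n : ℤ) := by
      rw [Int.floor_eq_iff]
      push_cast at hx ⊢
      exact ⟨hx.1.le, hx.2⟩
    rw [this]; push_cast; rfl
  rw [setIntegral_congr_fun measurableSet_Ioo hc, ← integral_Ioc_eq_integral_Ioo,
    ← intervalIntegral.integral_of_le (by push_cast; linarith)]
  have hle : (n : ℝ) ≤ ((n + 1 : ℕ) : ℝ) := by push_cast; linarith
  have hpos : ∀ x ∈ Set.uIcc (n : ℝ) ((n + 1 : ℕ) : ℝ), 0 < A + w * x := by
    intro x hx
    rw [Set.uIcc_of_le hle] at hx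
    exact pos_aux hA hw (le_trans (Nat.cast_nonneg n) hx.1)
  rw [intervalIntegral.integral_eq_sub_of_hasDerivAt
    (f := fun x : ℝ => (x - n) * (A + w * x) ^ (-p))]
  · simp
  · intro x hx
    have h1 : HasDerivAt (fun x : ℝ => x - n) 1 x := (hasDerivAt_id x).sub_const _
    have := h1.mul (hasDerivAt_aux (-p) x (hpos x hx))
    convert! this using 1
    rw [show -p - 1 = -(p + 1) by ring]
    ring
  · apply ContinuousOn.intervalIntegrable
    have hq : ∀ q : ℝ, ContinuousOn (fun x : ℝ => (A + w * x) ^ q)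
        (Set.uIcc (n : ℝ) ((n + 1 : ℕ) : ℝ)) := fun q x hx =>
      (hasDerivAt_aux q x (hpos x hx)).continuousAt.continuousWithinAt
    exact (hq _).sub (continuousOn_const.mul
      ((continuousOn_id.sub continuousOn_const).mul (hq _)))

lemma sawI_nonneg {A w p : ℝ} (hA : 0 < A) (hw : 0 < w) : 0 ≤ sawI A w p :=
  setIntegral_nonneg measurableSet_Ioi fun x hx => mul_nonneg (saw_nonneg x)
    (Real.rpow_pos_of_pos (pos_aux hA hw (le_of_lt hx)) _).le

lemma sawI_le {A w p : ℝ} (hA : 0 < A) (hw : 0 < w) (hp : 1 < p) :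
    sawI A w p ≤ A ^ (1 - p) / (w * (p - 1)) := by
  obtain ⟨i1, e1⟩ := pow_int hA hw hp
  rw [← e1]
  refine setIntegral_mono_on (saw_int i1) i1 measurableSet_Ioi fun x hx => ?_
  have := (Real.rpow_pos_of_pos (pos_aux hA hw (le_of_lt hx)) (-p)).le
  nlinarith [saw_le x]

lemma rpow_dom {x p q : ℝ} (hx : 0 < x) (h1 : p ≤ q) (h2 : q ≤ p + 1) :
    x ^ (-q) ≤ x ^ (-p) + x ^ (-(p + 1)) := by
  have a := Real.rpow_pos_of_pos hx (-p)
  have b := Real.rpow_pos_of_pos hx (-(p + 1))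
  rcases le_total 1 x with h | h
  · have := Real.rpow_le_rpow_of_exponent_le h (show -q ≤ -p by linarith)
    linarith
  · have := Real.rpow_le_rpow_of_exponent_ge hx h (show -(p + 1) ≤ -q by linarith)
    linarith

lemma rpow_tend {x p : ℝ} (hx : 0 < x) :
    Tendsto (fun q : ℝ => x ^ (-q)) (𝓝[>] p) (𝓝 (x ^ (-p))) := by
  have : Continuous (fun q : ℝ => x ^ (-q)) :=
    Real.continuous_const_rpow hx.ne' |>.comp continuous_neg
  exact (this.tendsto p).mono_left nhdsWithin_le_nhds

lemma ev_Ioo (p : ℝ) : ∀ᶠ q in 𝓝[>] p, p < q ∧ q < p + 1 :=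
  Ioo_mem_nhdsGT (by linarith)

lemma sawI_tend {A w p : ℝ} (hA : 0 < A) (hw : 0 < w) (hp : 1 < p) :
    Tendsto (fun q => sawI A w q) (𝓝[>] p) (𝓝 (sawI A w p)) := by
  obtain ⟨i1, -⟩ := pow_int hA hw hp
  obtain ⟨i2, -⟩ := pow_int hA hw (show 1 < p + 1 by linarith)
  refine tendsto_integral_filter_of_dominated_convergence
    (fun x => (A + w * x) ^ (-p) + (A + w * x) ^ (-(p + 1))) ?_ ?_ (i1.add i2) ?_
  · exact Eventually.of_forall fun q => by
      apply Measurable.aestronglyMeasurable; fun_prop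
  · filter_upwards [ev_Ioo p] with q hq
    refine (ae_restrict_iff' measurableSet_Ioi).2 (Eventually.of_forall fun x hx => ?_)
    have h0 := pos_aux hA hw (le_of_lt hx)
    apply saw_bound
    rw [abs_of_pos (Real.rpow_pos_of_pos h0 _)]
    exact rpow_dom h0 hq.1.le hq.2.le
  · refine (ae_restrict_iff' measurableSet_Ioi).2 (Eventually.of_forall fun x hx => ?_)
    exact (rpow_tend (pos_aux hA hw (le_of_lt hx))).const_mul _

/-- double sawtooth integral -/
noncomputable def sawJ (A v w p : ℝ) : ℝ :=
  ∫ x in Set.Ioi (0 : ℝ), (x - (⌊x⌋ : ℝ)) * sawI (A + w * x) v p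

lemma sawI_meas (A v w p : ℝ) : Measurable (fun x : ℝ => sawI (A + w * x) v p) := by
  unfold sawI
  refine (StronglyMeasurable.integral_prod_right (f := fun x y : ℝ =>
    (y - (⌊y⌋ : ℝ)) * (A + w * x + v * y) ^ (-p)) ?_).measurable
  apply Measurable.stronglyMeasurable
  unfold Function.uncurry
  fun_prop

lemma sawI_int {A v w p : ℝ} (hA : 0 < A) (hv : 0 < v) (hw : 0 < w) (hp : 2 < p) :
    IntegrableOn (fun x : ℝ => sawI (A + w * x) v p) (Set.Ioi 0) := by
  obtain ⟨i1, -⟩ := pow_int hA hw (show 1 < p - 1 by linarith)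
  refine Integrable.mono' (i1.div_const (v * (p - 1))) (sawI_meas A v w p).aestronglyMeasurable ?_
  refine (ae_restrict_iff' measurableSet_Ioi).2 (Eventually.of_forall fun x hx => ?_)
  have h0 := pos_aux hA hw (le_of_lt hx)
  rw [Real.norm_eq_abs, abs_of_nonneg (sawI_nonneg h0 hv), show -(p - 1) = 1 - p by ring]
  exact sawI_le h0 hv (by linarith)

lemma sawJ_tend {A v w p : ℝ} (hA : 0 < A) (hv : 0 < v) (hw : 0 < w) (hp : 2 < p) :
    Tendsto (fun q => sawJ A v w q) (𝓝[>] p) (𝓝 (sawJ A v w p)) := by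
  obtain ⟨i1, -⟩ := pow_int hA hw (show 1 < p - 1 by linarith)
  obtain ⟨i2, -⟩ := pow_int hA hw (show 1 < p - 1 + 1 by linarith)
  refine tendsto_integral_filter_of_dominated_convergence
    (fun x => ((A + w * x) ^ (-(p - 1)) + (A + w * x) ^ (-(p - 1 + 1))) / v) ?_ ?_
    ((i1.add i2).div_const v) ?_
  · exact Eventually.of_forall fun q =>
      (saw_meas.mul (sawI_meas A v w q)).aestronglyMeasurable
  · filter_upwards [ev_Ioo p] with q hq
    refine (ae_restrict_iff' measurableSet_Ioi).2 (Eventually.of_forall fun x hx => ?_)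
    have h0 := pos_aux hA hw (le_of_lt hx)
    apply saw_bound
    rw [abs_of_nonneg (sawI_nonneg h0 hv)]
    refine (sawI_le h0 hv (by linarith)).trans ?_
    have := rpow_dom h0 (show p - 1 ≤ q - 1 by linarith) (show q - 1 ≤ p - 1 + 1 by linarith)
    rw [show -(q - 1) = 1 - q by ring] at this
    have h1 := Real.rpow_pos_of_pos h0 (1 - q)
    gcongr
    nlinarith
  · refine (ae_restrict_iff' measurableSet_Ioi).2 (Eventually.of_forall fun x hx => ?_)
    exact (sawI_tend (pos_aux hA hw (le_of_lt hx)) hv (by linarith)).const_mul _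

/-- swap of the sum and the integral -/
lemma saw_swap {A v w p : ℝ} (hA : 0 < A) (hv : 0 < v) (hw : 0 < w) (hp : 2 < p) :
    HasSum (fun m : ℕ => sawI (A + v * ((m : ℝ) + 1)) w p)
      (sawI A w (p - 1) / (v * (p - 1)) - p * v * sawJ A v w (p + 1)) := by
  have hm : ∀ m : ℕ, 0 < A + v * ((m : ℝ) + 1) := fun m => by positivity
  have hint : ∀ m : ℕ, Integrable (fun x : ℝ => (x - (⌊x⌋ : ℝ)) *
      (A + v * ((m : ℝ) + 1) + w * x) ^ (-p)) (volume.restrict (Set.Ioi 0)) := fun m =>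
    saw_int (pow_int (hm m) hw (by linarith)).1
  have hsum : Summable (fun m : ℕ => sawI (A + v * ((m : ℝ) + 1)) w p) := by
    refine Summable.of_nonneg_of_le (fun m => sawI_nonneg (hm m) hw)
      (fun m => sawI_le (hm m) hw (by linarith)) ?_
    have := (tail_sum hA hv (show 1 < p - 1 by linarith)).summable.div_const (w * (p - 1))
    rwa [show -(p - 1) = 1 - p by ring] at this
  have key := hasSum_integral_of_summable_integral_norm hint (by
    convert hsum using 2 with m
    refine setIntegral_congr_fun measurableSet_Ioi fun x hx => ?_
    rw [Real.norm_of_nonneg]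
    exact mul_nonneg (saw_nonneg x)
      (Real.rpow_pos_of_pos (pos_aux (hm m) hw (le_of_lt hx)) _).le)
  convert! key using 1
  have e : ∀ x ∈ Set.Ioi (0 : ℝ), ∑' m : ℕ, (x - (⌊x⌋ : ℝ)) *
      (A + v * ((m : ℝ) + 1) + w * x) ^ (-p) =
      (x - (⌊x⌋ : ℝ)) * (A + w * x) ^ (-(p - 1)) / (v * (p - 1)) -
        p * v * ((x - (⌊x⌋ : ℝ)) * sawI (A + w * x) v (p + 1)) := by
    intro x hx
    have := (tail_sum (pos_aux hA hw (le_of_lt hx)) hv (show 1 < p by linarith)).tsum_eq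
    rw [tsum_mul_left]
    simp only [show ∀ m : ℕ, A + v * ((m : ℝ) + 1) + w * x = A + w * x + v * ((m : ℝ) + 1) from
      fun m => by ring]
    rw [this, show -(p - 1) = 1 - p by ring]
    ring
  rw [setIntegral_congr_fun measurableSet_Ioi e, integral_sub, integral_div, integral_const_mul]
  · rfl
  · exact (saw_int (pow_int hA hw (by linarith)).1).div_const _
  · exact (saw_int (sawI_int hA hv hw (by linarith))).const_mul _

lemma row_sum {A w p : ℝ} (hA : 0 < A) (hw : 0 < w) (hp : 1 < p) :
    HasSum (fun m : ℕ => (A + w * (m : ℝ)) ^ (-p))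
      (A ^ (-p) + (A ^ (1 - p) / (w * (p - 1)) - p * w * sawI A w (p + 1))) := by
  have := tail_sum hA hw hp
  rw [← hasSum_nat_add_iff' 1]
  simpa using this

lemma double_sum {A v w s : ℝ} (hA : 0 < A) (hv : 0 < v) (hw : 0 < w) (hs : 2 < s) :
    ∑' p : ℕ × ℕ, (A + (p.1 : ℝ) * v + (p.2 : ℝ) * w) ^ (-s) =
      ∑' m : ℕ, (A + v * (m : ℝ)) ^ (-s) + ∑' m : ℕ, (A + w * (m : ℝ)) ^ (-s) - A ^ (-s)
      + A ^ (2 - s) / (v * w * (s - 1) * (s - 2)) - (w / v) * sawI A w s - (v / w) * sawI A v s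
      + s * (s + 1) * v * w * sawJ A v w (s + 2) := by
  have hm : ∀ m : ℕ, 0 < A + v * (m : ℝ) := fun m => by positivity
  have hs1 : s - 1 ≠ 0 := by linarith
  have hs2 : s - 2 ≠ 0 := by linarith
  have hs0 : s ≠ 0 := by linarith
  have hinner : ∀ m : ℕ, HasSum (fun n : ℕ => (A + (m : ℝ) * v + (n : ℝ) * w) ^ (-s))
      ((A + v * (m : ℝ)) ^ (-s) + ((A + v * (m : ℝ)) ^ (1 - s) / (w * (s - 1))
        - s * w * sawI (A + v * (m : ℝ)) w (s + 1))) := by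
    intro m
    have := row_sum (hm m) hw (show 1 < s by linarith)
    simpa only [mul_comm v, mul_comm w (Nat.cast _)] using this
  -- the outer sum of the tails
  have hT := ((tail_sum hA hv (show 1 < s - 1 by linarith)).div_const (w * (s - 1))).sub
    ((saw_swap hA hv hw (show 2 < s + 1 by linarith)).mul_left (s * w))
  rw [show -(s - 1) = 1 - s by ring] at hT
  have hT' := (hasSum_nat_add_iff (f := fun m : ℕ => (A + v * (m : ℝ)) ^ (1 - s) / (w * (s - 1))
        - s * w * sawI (A + v * (m : ℝ)) w (s + 1)) 1).1
    (by simpa only [Nat.cast_add, Nat.cast_one] using hT)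
  have hA1 := row_sum hA hv (show 1 < s by linarith)
  have hO := hA1.summable.hasSum.add hT'
  have hsm : Summable (fun p : ℕ × ℕ => (A + (p.1 : ℝ) * v + (p.2 : ℝ) * w) ^ (-s)) := by
    rw [summable_prod_of_nonneg]
    · refine ⟨fun m => (hinner m).summable, ?_⟩
      simp only [fun m => (hinner m).tsum_eq]
      exact hO.summable
    · intro p
      have : 0 < A + (p.1 : ℝ) * v + (p.2 : ℝ) * w := by positivity
      exact (Real.rpow_pos_of_pos this _).le
  rw [hsm.tsum_prod]
  simp only [fun m => (hinner m).tsum_eq]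
  rw [hO.tsum_eq, (row_sum hA hw (show 1 < s by linarith)).tsum_eq]
  simp only [Finset.sum_range_one, Nat.cast_zero, mul_zero, add_zero]
  rw [show 1 - (s - 1) = 2 - s by ring, show s - 1 + 1 = s by ring, show s + 1 - 1 = s by ring,
    show s + 1 + 1 = s + 2 by ring, show s - 1 - 1 = s - 2 by ring]
  field_simp
  ring

lemma row_tend {A w p : ℝ} (hA : 0 < A) (hw : 0 < w) (hp : 1 < p) :
    Tendsto (fun q => ∑' m : ℕ, (A + w * (m : ℝ)) ^ (-q)) (𝓝[>] p)
      (𝓝 (∑' m : ℕ, (A + w * (m : ℝ)) ^ (-p))) := by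
  have hm : ∀ m : ℕ, 0 < A + w * (m : ℝ) := fun m => by positivity
  refine tendsto_tsum_of_dominated_convergence ((row_sum hA hw hp).summable.add
    (row_sum hA hw (show 1 < p + 1 by linarith)).summable) (fun m => rpow_tend (hm m)) ?_
  filter_upwards [ev_Ioo p] with q hq m
  rw [Real.norm_of_nonneg (Real.rpow_pos_of_pos (hm m) _).le]
  exact rpow_dom (hm m) hq.1.le hq.2.le

lemma main_term {A : ℝ} (hA : 0 < A) :
    Tendsto (fun s : ℝ => A ^ (2 - s) / ((s - 1) * (s - 2)) - 1 / (s - 2)) (𝓝[>] 2)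
      (𝓝 (-(1 + Real.log A))) := by
  have hd : HasDerivAt (fun s : ℝ => A ^ (2 - s) / (s - 1)) (-(1 + Real.log A)) 2 := by
    have h1 : HasDerivAt (fun s : ℝ => 2 - s) (-1) 2 := (hasDerivAt_id (2 : ℝ)).const_sub 2
    have h2 := h1.const_rpow hA
    have h3 : HasDerivAt (fun s : ℝ => s - 1) 1 2 := (hasDerivAt_id (2 : ℝ)).sub_const 1
    have := h2.div h3 (by norm_num)
    convert! this using 1
    norm_num
    ring
  have := (hasDerivAt_iff_tendsto_slope.1 hd).mono_left
    (nhdsWithin_mono (2 : ℝ) (fun x hx => ne_of_gt hx : Set.Ioi (2 : ℝ) ⊆ {2}ᶜ))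
  refine this.congr' ?_
  filter_upwards [ev_Ioo 2] with s hs
  have hs1 : s - 1 ≠ 0 := by linarith
  have hs2 : s - 2 ≠ 0 := by linarith
  rw [slope_def_field]
  norm_num
  field_simp

lemma real_limit {A v w : ℝ} (hA : 0 < A) (hv : 0 < v) (hw : 0 < w) :
    Tendsto (fun s : ℝ => ∑' p : ℕ × ℕ, (A + (p.1 : ℝ) * v + (p.2 : ℝ) * w) ^ (-s)
        - 1 / (v * w * (s - 2))) (𝓝[>] 2)
      (𝓝 (∑' m : ℕ, (A + v * (m : ℝ)) ^ (-2 : ℝ) + ∑' m : ℕ, (A + w * (m : ℝ)) ^ (-2 : ℝ)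
        - A ^ (-2 : ℝ) + (-(1 + Real.log A)) / (v * w)
        - (w / v) * sawI A w 2 - (v / w) * sawI A v 2
        + 2 * (2 + 1) * v * w * sawJ A v w 4)) := by
  have hid : Tendsto (fun s : ℝ => s) (𝓝[>] 2) (𝓝 2) := nhdsWithin_le_nhds
  have hshift : Tendsto (fun s : ℝ => s + 2) (𝓝[>] 2) (𝓝[>] 4) := by
    refine tendsto_nhdsWithin_iff.2 ⟨?_, ?_⟩
    · have := hid.add_const 2
      norm_num at this
      exact this
    · filter_upwards [ev_Ioo 2] with s hs
      simp only [Set.mem_Ioi]; linarith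
  have hJ := (sawJ_tend hA hv hw (show (2 : ℝ) < 4 by norm_num)).comp hshift
  have h := ((((((row_tend hA hv one_lt_two).add (row_tend hA hw one_lt_two)).sub
    (rpow_tend hA)).add ((main_term hA).div_const (v * w))).sub
    ((sawI_tend hA hw one_lt_two).const_mul (w / v))).sub
    ((sawI_tend hA hv one_lt_two).const_mul (v / w))).add
    (((((hid.mul (hid.add_const 1)).mul_const v).mul_const w)).mul hJ)
  refine h.congr' ?_
  filter_upwards [ev_Ioo 2] with s hs
  have hs1 : s - 1 ≠ 0 := by linarith
  have hs2 : s - 2 ≠ 0 := by linarith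
  rw [double_sum hA hv hw hs.1]
  simp only [Function.comp]
  field_simp
  ring

lemma rpow_neg_two' {x : ℝ} (hx : 0 < x) : x ^ (-2 : ℝ) = 1 / x ^ 2 := by
  rw [Real.rpow_neg hx.le, one_div]
  norm_num

lemma hurwitz {A v : ℝ} (hA : 0 < A) (hv : 0 < v) :
    ∑' m : ℕ, (A + v * (m : ℝ)) ^ (-2 : ℝ) =
      (1 / v ^ 2) * (∑' m : ℕ, 1 / ((m : ℝ) + A / v) ^ 2) := by
  rw [← tsum_mul_left]
  congr 1; funext m
  have : 0 < A + v * (m : ℝ) := by positivity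
  rw [rpow_neg_two' this, show A + v * (m : ℝ) = v * (m + A / v) by field_simp; ring, mul_pow]
  rw [one_div_mul_one_div]

lemma sawI_two {A w : ℝ} (hA : 0 < A) (hw : 0 < w) :
    sawI A w 2 = ∫ x in Set.Ioi (0 : ℝ), (x - (⌊x⌋ : ℝ)) / (A + w * x) ^ 2 := by
  refine setIntegral_congr_fun measurableSet_Ioi fun x hx => ?_
  rw [rpow_neg_two' (pos_aux hA hw (le_of_lt hx))]
  ring

lemma sawJ_four {A v w : ℝ} (hA : 0 < A) (hv : 0 < v) (hw : 0 < w) :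
    sawJ A v w 4 = ∫ x in Set.Ioi (0 : ℝ), ∫ y in Set.Ioi (0 : ℝ),
            (x - (⌊x⌋ : ℝ)) * (y - (⌊y⌋ : ℝ)) / (A + v * y + w * x) ^ 4 := by
  refine setIntegral_congr_fun measurableSet_Ioi fun x hx => ?_
  simp only [sawI]
  rw [← integral_const_mul]
  refine setIntegral_congr_fun measurableSet_Ioi fun y hy => ?_
  have h0 : 0 < A + w * x + v * y := pos_aux (pos_aux hA hw (le_of_lt hx)) hv (le_of_lt hy)
  have : (A + w * x + v * y) ^ (-4 : ℝ) = 1 / (A + v * y + w * x) ^ 4 := by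
    rw [Real.rpow_neg h0.le, one_div, show A + v * y + w * x = A + w * x + v * y by ring]
    norm_num
  rw [this]
  ring

lemma mero_limit {f : ℂ → ℂ} {L : ℂ} (hf : MeromorphicAt f 2)
    (h : Tendsto (fun s : ℝ => f s) (𝓝[>] 2) (𝓝 L)) : Tendsto f (𝓝[≠] 2) (𝓝 L) := by
  have hc : Tendsto (fun s : ℝ => (s : ℂ)) (𝓝[>] 2) (𝓝[≠] 2) := by
    refine tendsto_nhdsWithin_iff.2 ⟨?_, ?_⟩
    · have := (Complex.continuous_ofReal.tendsto 2).mono_left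
        (nhdsWithin_le_nhds (s := Set.Ioi (2 : ℝ)))
      simpa using this
    · filter_upwards [ev_Ioo 2] with s hs
      simp only [Set.mem_compl_iff, Set.mem_singleton_iff]
      intro h
      have : s = 2 := by exact_mod_cast h
      linarith
  rcases lt_or_ge (meromorphicOrderAt f 2) 0 with h0 | h0
  · have := ((tendsto_cobounded_iff_meromorphicOrderAt_neg hf).2 h0).comp hc
    exact absurd h (this.not_tendsto (Metric.disjoint_nhds_cobounded L).symm)
  · obtain ⟨c, hc'⟩ := tendsto_nhds_of_meromorphicOrderAt_nonneg hf h0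
    rwa [tendsto_nhds_unique h (hc'.comp hc)]

end BarnesAux

/-- Integral representation of the constant term `γ₀(2,α;v,w)` in the Laurent
expansion of the Barnes double zeta-function at `s = 2`. -/
theorem barnes_gamma0_integral_representation
    (α v w : ℝ) (hα : 0 < α) (hv : 0 < v) (hw : 0 < w)
    (Z : ℂ → ℂ)
    (hmero : MeromorphicOn Z Set.univ)
    (hZ : ∀ s : ℂ, 2 < s.re →
      Z s = ∑' p : ℕ × ℕ, ((α + (p.1 : ℝ) * v + (p.2 : ℝ) * w : ℝ) : ℂ) ^ (-s)) :
    Tendsto (fun s : ℂ => Z s - 1 / ((v * w : ℝ) * (s - 2)))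
      (𝓝[≠] (2 : ℂ))
      (𝓝 ((- (1 / α ^ 2) - (1 + Real.log α) / (v * w)
        + (1 / v ^ 2) * (∑' m : ℕ, 1 / ((m : ℝ) + α / v) ^ 2)
        + (1 / w ^ 2) * (∑' m : ℕ, 1 / ((m : ℝ) + α / w) ^ 2)
        - (w / v) * (∫ x in Set.Ioi (0 : ℝ), (x - (⌊x⌋ : ℝ)) / (α + w * x) ^ 2)
        - (v / w) * (∫ y in Set.Ioi (0 : ℝ), (y - (⌊y⌋ : ℝ)) / (α + v * y) ^ 2)
        + 6 * v * w * (∫ x in Set.Ioi (0 : ℝ), ∫ y in Set.Ioi (0 : ℝ),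
            (x - (⌊x⌋ : ℝ)) * (y - (⌊y⌋ : ℝ)) / (α + v * y + w * x) ^ 4) : ℝ) : ℂ)) := by
  have hf : MeromorphicAt (fun s : ℂ => Z s - 1 / ((v * w : ℝ) * (s - 2))) 2 := by
    have := hmero 2 (Set.mem_univ _)
    refine this.sub ?_
    refine (MeromorphicAt.const 1 2).div ((MeromorphicAt.const _ 2).mul ?_)
    exact (MeromorphicAt.id 2).sub (MeromorphicAt.const 2 2)
  refine BarnesAux.mero_limit hf ?_
  have h := (Complex.continuous_ofReal.tendsto _).comp (BarnesAux.real_limit hα hv hw)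
  rw [BarnesAux.hurwitz hα hv, BarnesAux.hurwitz hα hw, BarnesAux.sawI_two hα hw,
    BarnesAux.sawI_two hα hv, BarnesAux.sawJ_four hα hv hw, BarnesAux.rpow_neg_two' hα] at h
  have h2 := h.congr' (f₂ := fun s : ℝ => Z s - 1 / ((v * w : ℝ) * ((s : ℂ) - 2))) (by
    filter_upwards [BarnesAux.ev_Ioo 2] with s hs
    rw [hZ s (by simpa using hs.1)]
    simp only [Function.comp]
    rw [Complex.ofReal_sub, Complex.ofReal_tsum]
    congr 1
    · congr 1; funext p
      have : 0 < α + (p.1 : ℝ) * v + (p.2 : ℝ) * w := by positivity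
      rw [Complex.ofReal_cpow this.le]
      push_cast; rfl
    · push_cast; rfl)
  convert! h2 using 2
  congr 1
  ring
end
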